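/- arXiv:2007.04918 — 4 statements merged into one kernel-verified Lean document; each statement's English description precedes it below -/
import Mathlib

section
/- Fix r with 1/3 < r < 3 and b with 0 < b < 2/(3+r). Let u be an admissible smooth solution of the 2D Zakharov–Kuznetsov equation on [2,∞) with sup_{t≥2} ‖u(t,·)‖_{L²(ℝ²)} < ∞, and set Ω(t) = {(x,y) ∈ ℝ² : |x| < t^b and |y| < t^{b r}}. Then the time integral ∫_{10}^∞ (1/(t log t)) ( ∫_{Ω(t)} u(t,x,y)² dx dy ) dt is finite. -/
open MeasureTheory Filter

noncomputable section

/-- Partial derivative in time of a function `u(t,x,y)`. -/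
def pt2 (u : ℝ → ℝ → ℝ → ℝ) : ℝ → ℝ → ℝ → ℝ := fun t x y => deriv (fun s => u s x y) t

/-- Partial derivative in the first space variable of a function `u(t,x,y)`. -/
def px2 (u : ℝ → ℝ → ℝ → ℝ) : ℝ → ℝ → ℝ → ℝ := fun t x y => deriv (fun a => u t a y) x

/-- Partial derivative in the second space variable of a function `u(t,x,y)`. -/
def py2 (u : ℝ → ℝ → ℝ → ℝ) : ℝ → ℝ → ℝ → ℝ := fun t x y => deriv (fun c => u t x c) y

/-- Iterated partial derivatives of `u(t,x,y)`, indexed by a list of directions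
(`0` = t, `1` = x, `2` = y). -/
def D2 (u : ℝ → ℝ → ℝ → ℝ) : List (Fin 3) → (ℝ → ℝ → ℝ → ℝ)
  | [] => u
  | i :: l => if i = 0 then pt2 (D2 u l) else if i = 1 then px2 (D2 u l) else py2 (D2 u l)

/-- An admissible smooth solution of the 2D Zakharov–Kuznetsov equation
`∂ₜu + ∂ₓ(∂ₓ²u + ∂ᵧ²u) + u ∂ₓu = 0` on `[2,∞)`: it is `C^∞`, solves the equation
pointwise for `t ≥ 2`, and all iterated partial derivatives decay in space faster
than any polynomial, locally uniformly in time. -/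
structure IsAdmissibleZK2 (u : ℝ → ℝ → ℝ → ℝ) : Prop where
  smooth : ContDiff ℝ (⊤ : ℕ∞) (fun p : ℝ × ℝ × ℝ => u p.1 p.2.1 p.2.2)
  eqn : ∀ t x y : ℝ, 2 ≤ t →
    pt2 u t x y
      + px2 (fun t' x' y' => px2 (px2 u) t' x' y' + py2 (py2 u) t' x' y') t x y
      + u t x y * px2 u t x y = 0
  decay : ∀ (l : List (Fin 3)) (N : ℕ) (a b : ℝ), 2 ≤ a →
    ∃ C : ℝ, ∀ t x y : ℝ, t ∈ Set.Icc a b →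
      (1 + |x| + |y|) ^ N * |D2 u l t x y| ≤ C


/-- The profile `1 / (1 + z²)`. -/
def bump (z : ℝ) : ℝ := (1 + z ^ 2)⁻¹

/-- The first derivative of `bump`. -/
def bump₁ (z : ℝ) : ℝ := -2 * z * (bump z) ^ 2

/-- The second derivative of `bump`. -/
def bump₂ (z : ℝ) : ℝ := -2 * (bump z) ^ 2 + 8 * z ^ 2 * (bump z) ^ 3

lemma bump_pos (z : ℝ) : 0 < bump z := by unfold bump; positivity

lemma bump_le_one (z : ℝ) : bump z ≤ 1 := by
  unfold bump
  exact inv_le_one_of_one_le₀ (by nlinarith [sq_nonneg z])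

lemma sq_mul_bump (z : ℝ) : z ^ 2 * bump z = 1 - bump z := by
  unfold bump
  field_simp
  ring

lemma abs_bump₁_le (z : ℝ) : |bump₁ z| ≤ 1 := by
  have h := sq_mul_bump z
  have h0 := bump_pos z
  have h1 := bump_le_one z
  rw [← sq_le_one_iff_abs_le_one]
  have : bump₁ z ^ 2 = 4 * (bump z) ^ 3 * (z ^ 2 * bump z) := by unfold bump₁; ring
  rw [this, h]
  have h2 : 4 * bump z * (1 - bump z) ≤ 1 := by nlinarith [sq_nonneg (2 * bump z - 1)]
  have h3 : bump z ^ 2 ≤ 1 := pow_le_one₀ h0.le h1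
  have h4 : 0 ≤ 4 * bump z * (1 - bump z) := mul_nonneg (by positivity) (by linarith)
  calc 4 * bump z ^ 3 * (1 - bump z) = bump z ^ 2 * (4 * bump z * (1 - bump z)) := by ring
    _ ≤ 1 * 1 := mul_le_mul h3 h2 h4 zero_le_one
    _ = 1 := one_mul 1

lemma abs_bump₂_le (z : ℝ) : |bump₂ z| ≤ 6 * bump z := by
  have h := sq_mul_bump z
  have h0 := bump_pos z
  have h1 := bump_le_one z
  have e : bump₂ z = bump z * (bump z * (6 - 8 * bump z)) := by
    have : bump₂ z = -2 * bump z ^ 2 + 8 * (z ^ 2 * bump z) * bump z ^ 2 := by unfold bump₂; ring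
    rw [this, h]; ring
  rw [e, abs_mul, abs_of_pos h0, mul_comm]
  refine mul_le_mul_of_nonneg_right ?_ h0.le
  rw [abs_le]
  constructor <;> nlinarith

lemma bump₂_sq_le (z : ℝ) : bump₂ z ^ 2 ≤ 36 * bump z := by
  have h0 := bump_pos z
  have h1 := bump_le_one z
  have h2 : bump₂ z ^ 2 ≤ (6 * bump z) ^ 2 :=
    sq_le_sq' (abs_le.1 (abs_bump₂_le z)).1 (abs_le.1 (abs_bump₂_le z)).2
  nlinarith

lemma hasDerivAt_bump (z : ℝ) : HasDerivAt bump (bump₁ z) z := by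
  have h : HasDerivAt (fun x : ℝ => 1 + x ^ 2) (2 * z) z := by
    simpa using (hasDerivAt_pow 2 z).const_add 1
  have e : -(2 * z) / (1 + z ^ 2) ^ 2 = bump₁ z := by
    unfold bump₁ bump
    field_simp
  rw [← e]
  exact h.inv (by positivity)

lemma hasDerivAt_bump₁ (z : ℝ) : HasDerivAt bump₁ (bump₂ z) z := by
  have h := ((hasDerivAt_id z).const_mul (-2)).mul ((hasDerivAt_bump z).pow 2)
  refine h.congr_deriv ?_
  simp only [bump₂, bump₁, id, Pi.pow_apply]
  push_cast
  ring

lemma continuous_bump : Continuous bump :=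
  continuous_iff_continuousAt.2 fun z => (hasDerivAt_bump z).continuousAt

lemma continuous_bump₁ : Continuous bump₁ :=
  continuous_iff_continuousAt.2 fun z => (hasDerivAt_bump₁ z).continuousAt

lemma continuous_bump₂ : Continuous bump₂ := by
  have := continuous_bump
  unfold bump₂
  fun_prop

lemma integrable_bump_div {A : ℝ} (hA : 0 < A) : Integrable fun x => bump (x / A) :=
  (show Integrable bump volume from integrable_inv_one_add_sq).comp_div hA.ne'

lemma integral_bump_div {A : ℝ} (hA : 0 < A) : ∫ x, bump (x / A) = Real.pi * A := by
  rw [Measure.integral_comp_div]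
  simp only [bump, integral_univ_inv_one_add_sq, abs_of_pos hA, smul_eq_mul, mul_comm]

lemma integrable_bump_prod {A B : ℝ} (hA : 0 < A) (hB : 0 < B) :
    Integrable fun p : ℝ × ℝ => bump (p.1 / A) * bump (p.2 / B) :=
  (integrable_bump_div hA).mul_prod (integrable_bump_div hB)

lemma integral_bump_prod {A B : ℝ} (hA : 0 < A) (hB : 0 < B) :
    ∫ p : ℝ × ℝ, bump (p.1 / A) * bump (p.2 / B) = Real.pi ^ 2 * (A * B) := by
  have := integral_prod_mul (μ := volume) (ν := volume)
    (fun x : ℝ => bump (x / A)) (fun x : ℝ => bump (x / B))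
  rw [integral_bump_div hA, integral_bump_div hB] at this
  rw [Measure.volume_eq_prod, this]
  ring

lemma sq_arctan_sub_arctan_div_le {a A : ℝ} (ha : 0 < a) (haA : a ≤ A) (x : ℝ) :
    (Real.arctan (x / a) - Real.arctan (x / A)) ^ 2 ≤ 5 * bump (x / A) := by
  wlog hx : 0 ≤ x generalizing x
  · have := this (-x) (by linarith)
    simp only [neg_div, Real.arctan_neg, bump, neg_sq] at this ⊢
    linarith [this]
  have hA : 0 < A := ha.trans_le haA
  have hz : 0 ≤ x / A := by positivity
  have h1 : Real.arctan (x / A) ≤ Real.arctan (x / a) :=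
    Real.arctan_mono (div_le_div_of_nonneg_left hx ha haA)
  have h2 := Real.arctan_lt_pi_div_two (x / a)
  set d := Real.arctan (x / a) - Real.arctan (x / A) with hd
  have hd0 : 0 ≤ d := by linarith
  have hd1 : d ≤ 2 := by
    have := Real.arctan_nonneg.2 hz
    have := Real.pi_le_four
    linarith
  have hd2 : d * (x / A) ≤ 1 := by
    rcases hz.eq_or_lt with h | h
    · rw [← h]; simp
    have h3 : d ≤ (x / A)⁻¹ := by
      have h4 := Real.arctan_inv_of_pos h
      have h5 : Real.arctan (x / A)⁻¹ ≤ (x / A)⁻¹ := by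
        have h6 : 0 ≤ (x / A)⁻¹ := by positivity
        have h7 := Real.le_tan (Real.arctan_nonneg.2 h6) (Real.arctan_lt_pi_div_two _)
        rwa [Real.tan_arctan] at h7
      linarith
    calc d * (x / A) ≤ (x / A)⁻¹ * (x / A) := by gcongr
      _ = 1 := inv_mul_cancel₀ h.ne'
  have h8 : d ^ 2 * (1 + (x / A) ^ 2) ≤ 5 := by
    have : (d * (x / A)) ^ 2 ≤ 1 := pow_le_one₀ (by positivity) hd2
    nlinarith
  unfold bump
  rw [← div_eq_mul_inv, le_div_iff₀ (by positivity)]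
  exact h8

section Smoothness

variable {u : ℝ → ℝ → ℝ → ℝ}

lemma hasDerivAt_pt2
    (hu : ContDiff ℝ (⊤ : ℕ∞) (fun p : ℝ × ℝ × ℝ => u p.1 p.2.1 p.2.2)) (t x y : ℝ) :
    HasDerivAt (fun s => u s x y) (pt2 u t x y) t := by
  refine DifferentiableAt.hasDerivAt ?_
  have h := (hu.differentiable (by simp)).comp
    (show Differentiable ℝ fun s : ℝ => (s, x, y) by fun_prop)
  exact h t

lemma hasDerivAt_px2
    (hu : ContDiff ℝ (⊤ : ℕ∞) (fun p : ℝ × ℝ × ℝ => u p.1 p.2.1 p.2.2)) (t x y : ℝ) :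
    HasDerivAt (fun a => u t a y) (px2 u t x y) x := by
  refine DifferentiableAt.hasDerivAt ?_
  have h := (hu.differentiable (by simp)).comp
    (show Differentiable ℝ fun a : ℝ => (t, a, y) by fun_prop)
  exact h x

lemma hasDerivAt_py2
    (hu : ContDiff ℝ (⊤ : ℕ∞) (fun p : ℝ × ℝ × ℝ => u p.1 p.2.1 p.2.2)) (t x y : ℝ) :
    HasDerivAt (fun c => u t x c) (py2 u t x y) y := by
  refine DifferentiableAt.hasDerivAt ?_
  have h := (hu.differentiable (by simp)).comp
    (show Differentiable ℝ fun c : ℝ => (t, x, c) by fun_prop)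
  exact h y

lemma contDiff_fderiv_apply
    (hu : ContDiff ℝ (⊤ : ℕ∞) (fun p : ℝ × ℝ × ℝ => u p.1 p.2.1 p.2.2)) (v : ℝ × ℝ × ℝ) :
    ContDiff ℝ (⊤ : ℕ∞)
      (fun p => fderiv ℝ (fun p : ℝ × ℝ × ℝ => u p.1 p.2.1 p.2.2) p v) :=
  (hu.fderiv_right (m := (⊤ : ℕ∞)) (by simp)).clm_apply contDiff_const

lemma contDiff_D2
    (hu : ContDiff ℝ (⊤ : ℕ∞) (fun p : ℝ × ℝ × ℝ => u p.1 p.2.1 p.2.2)) (l : List (Fin 3)) :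
    ContDiff ℝ (⊤ : ℕ∞) (fun p : ℝ × ℝ × ℝ => D2 u l p.1 p.2.1 p.2.2) := by
  induction l with
  | nil => exact hu
  | cons i l ih =>
    have hd : ∀ p, HasFDerivAt (fun p : ℝ × ℝ × ℝ => D2 u l p.1 p.2.1 p.2.2)
        (fderiv ℝ (fun p : ℝ × ℝ × ℝ => D2 u l p.1 p.2.1 p.2.2) p) p := fun p =>
      (ih.differentiable (by simp) p).hasFDerivAt
    simp only [D2]
    split_ifs
    · convert contDiff_fderiv_apply ih (1, 0, 0) using 2 with p
      exact (hasDerivAt_pt2 ih p.1 p.2.1 p.2.2).unique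
        (HasFDerivAt.comp_hasDerivAt (l := fun p : ℝ × ℝ × ℝ => D2 u l p.1 p.2.1 p.2.2) p.1 (hd p) ((hasDerivAt_id p.1).prodMk
          ((hasDerivAt_const p.1 p.2.1).prodMk (hasDerivAt_const p.1 p.2.2))))
    · convert contDiff_fderiv_apply ih (0, 1, 0) using 2 with p
      exact (hasDerivAt_px2 ih p.1 p.2.1 p.2.2).unique
        (HasFDerivAt.comp_hasDerivAt (l := fun p : ℝ × ℝ × ℝ => D2 u l p.1 p.2.1 p.2.2) p.2.1 (hd p) ((hasDerivAt_const p.2.1 p.1).prodMk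
          ((hasDerivAt_id p.2.1).prodMk (hasDerivAt_const p.2.1 p.2.2))))
    · convert contDiff_fderiv_apply ih (0, 0, 1) using 2 with p
      exact (hasDerivAt_py2 ih p.1 p.2.1 p.2.2).unique
        (HasFDerivAt.comp_hasDerivAt (l := fun p : ℝ × ℝ × ℝ => D2 u l p.1 p.2.1 p.2.2) p.2.2 (hd p) ((hasDerivAt_const p.2.2 p.1).prodMk
          ((hasDerivAt_const p.2.2 p.2.1).prodMk (hasDerivAt_id p.2.2))))

lemma continuous_D2_slice
    (hu : ContDiff ℝ (⊤ : ℕ∞) (fun p : ℝ × ℝ × ℝ => u p.1 p.2.1 p.2.2)) (l : List (Fin 3))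
    (t : ℝ) : Continuous fun p : ℝ × ℝ => D2 u l t p.1 p.2 :=
  (contDiff_D2 hu l).continuous.comp (show Continuous fun p : ℝ × ℝ => (t, p.1, p.2) by fun_prop)

end Smoothness

lemma integral_eq_zero_of_hasLineDerivAt {F F' : ℝ × ℝ → ℝ} {v : ℝ × ℝ} (hF : Integrable F)
    (hF' : Integrable F') (h : ∀ p, HasLineDerivAt ℝ F (F' p) p v) : ∫ p, F' p = 0 := by
  have := integral_bilinear_hasLineDerivAt_right_eq_neg_left_of_integrable (μ := volume)
    (f := F) (f' := F') (g := fun _ => (1 : ℝ)) (g' := fun _ => (0 : ℝ)) (v := v)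
    (B := ContinuousLinearMap.mul ℝ ℝ) (by simpa using hF') (by simp) (by simpa using hF)
    (fun p _ => h p) (fun p _ => by simpa [HasLineDerivAt] using hasDerivAt_const (0 : ℝ) (1 : ℝ))
  simpa using this.symm

lemma hasLineDerivAt_fst {F : ℝ × ℝ → ℝ} {p : ℝ × ℝ} {d : ℝ}
    (h : HasDerivAt (fun a => F (a, p.2)) d p.1) : HasLineDerivAt ℝ F d p (1, 0) := by
  have h2 : HasDerivAt (fun s : ℝ => p.1 + s) 1 0 := by
    simpa using (hasDerivAt_id (0 : ℝ)).const_add p.1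
  have h3 : HasDerivAt (fun a => F (a, p.2)) d (p.1 + 0) := by simpa using h
  simpa [HasLineDerivAt, Function.comp_def, Prod.add_def] using h3.comp (0 : ℝ) h2

lemma hasLineDerivAt_snd {F : ℝ × ℝ → ℝ} {p : ℝ × ℝ} {d : ℝ}
    (h : HasDerivAt (fun c => F (p.1, c)) d p.2) : HasLineDerivAt ℝ F d p (0, 1) := by
  have h2 : HasDerivAt (fun s : ℝ => p.2 + s) 1 0 := by
    simpa using (hasDerivAt_id (0 : ℝ)).const_add p.2
  have h3 : HasDerivAt (fun c => F (p.1, c)) d (p.2 + 0) := by simpa using h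
  simpa [HasLineDerivAt, Function.comp_def, Prod.add_def] using h3.comp (0 : ℝ) h2

/-- Weighted arithmetic-geometric form of the Cauchy–Schwarz inequality. -/
lemma abs_integral_mul_le {v w : ℝ × ℝ → ℝ} {C M : ℝ} (hM : 0 < M)
    (hv : Integrable fun p => v p ^ 2) (hw : Integrable fun p => w p ^ 2)
    (hvC : ∫ p, v p ^ 2 ≤ C) (hwM : ∫ p, w p ^ 2 ≤ M ^ 2) :
    |∫ p, v p * w p| ≤ M * (C + 1) := by
  have hi : Integrable fun p => M * v p ^ 2 + M⁻¹ * w p ^ 2 :=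
    (hv.const_mul M).add (hw.const_mul M⁻¹)
  have h1 : ‖∫ p, v p * w p‖ ≤ ∫ p, (M * v p ^ 2 + M⁻¹ * w p ^ 2) := by
    refine norm_integral_le_of_norm_le hi (Eventually.of_forall fun p => ?_)
    have e : M * v p ^ 2 + M⁻¹ * w p ^ 2 = M⁻¹ * ((M * v p) ^ 2 + w p ^ 2) := by
      field_simp
    have e2 : ‖v p * w p‖ = M⁻¹ * |M * v p * w p| := by
      rw [Real.norm_eq_abs, mul_assoc, abs_mul M, abs_of_pos hM]
      field_simp
    rw [e, e2]
    refine mul_le_mul_of_nonneg_left ?_ (by positivity)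
    rw [abs_le]
    constructor <;> nlinarith [sq_nonneg (M * v p + w p), sq_nonneg (M * v p - w p),
      sq_nonneg (M * v p), sq_nonneg (w p)]
  rw [integral_add (hv.const_mul M) (hw.const_mul M⁻¹), integral_const_mul,
    integral_const_mul] at h1
  calc |∫ p, v p * w p| ≤ M * (∫ p, v p ^ 2) + M⁻¹ * ∫ p, w p ^ 2 := h1
    _ ≤ M * C + M⁻¹ * M ^ 2 := by gcongr
    _ = M * (C + 1) := by field_simp

/-- Bounded continuous real functions. -/
def IsBddCont {X : Type*} [TopologicalSpace X] (f : X → ℝ) : Prop :=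
  Continuous f ∧ ∃ K, ∀ x, |f x| ≤ K

namespace IsBddCont

variable {X Y : Type*} [TopologicalSpace X] [TopologicalSpace Y] {f g : X → ℝ}

lemma mul (hf : IsBddCont f) (hg : IsBddCont g) : IsBddCont fun x => f x * g x := by
  obtain ⟨hfc, K, hK⟩ := hf
  obtain ⟨hgc, L, hL⟩ := hg
  refine ⟨hfc.mul hgc, K * L, fun x => ?_⟩
  rw [abs_mul]
  exact mul_le_mul (hK x) (hL x) (abs_nonneg _) ((abs_nonneg _).trans (hK x))

lemma sub (hf : IsBddCont f) (hg : IsBddCont g) : IsBddCont fun x => f x - g x := by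
  obtain ⟨hfc, K, hK⟩ := hf
  obtain ⟨hgc, L, hL⟩ := hg
  exact ⟨hfc.sub hgc, K + L, fun x => (abs_sub _ _).trans (add_le_add (hK x) (hL x))⟩

lemma comp (hf : IsBddCont f) {φ : Y → X} (hφ : Continuous φ) : IsBddCont fun y => f (φ y) :=
  ⟨hf.1.comp hφ, hf.2.imp fun _ h y => h (φ y)⟩

lemma div_const (hf : IsBddCont f) (c : ℝ) : IsBddCont fun x => f x / c := by
  obtain ⟨hfc, K, hK⟩ := hf
  refine ⟨hfc.div_const c, K / |c|, fun x => ?_⟩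
  rw [abs_div]
  exact div_le_div_of_nonneg_right (hK x) (abs_nonneg c)

lemma fst {f : ℝ → ℝ} (hf : IsBddCont f) : IsBddCont fun p : ℝ × ℝ => f p.1 :=
  hf.comp continuous_fst

lemma snd {f : ℝ → ℝ} (hf : IsBddCont f) : IsBddCont fun p : ℝ × ℝ => f p.2 :=
  hf.comp continuous_snd

end IsBddCont

lemma isBddCont_bump : IsBddCont bump :=
  ⟨continuous_bump, 1, fun z => by rw [abs_of_pos (bump_pos z)]; exact bump_le_one z⟩

lemma isBddCont_bump₁ : IsBddCont bump₁ := ⟨continuous_bump₁, 1, abs_bump₁_le⟩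

lemma isBddCont_bump₂ : IsBddCont bump₂ :=
  ⟨continuous_bump₂, 6, fun z => (abs_bump₂_le z).trans (by linarith [bump_le_one z])⟩

lemma isBddCont_arctan : IsBddCont Real.arctan :=
  ⟨Real.continuous_arctan, Real.pi / 2, fun z =>
    abs_le.2 ⟨(Real.neg_pi_div_two_lt_arctan z).le, (Real.arctan_lt_pi_div_two z).le⟩⟩

namespace IsAdmissibleZK2

variable {u : ℝ → ℝ → ℝ → ℝ}

lemma exists_abs_D2_le (hu : IsAdmissibleZK2 u) (l : List (Fin 3)) (a b : ℝ) (ha : 2 ≤ a) :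
    ∃ C : ℝ, 0 ≤ C ∧ ∀ t ∈ Set.Icc a b, ∀ x y, |D2 u l t x y| ≤ C * (bump x * bump y) := by
  obtain ⟨C, hC⟩ := hu.decay l 4 a b ha
  refine ⟨max C 0, le_max_right _ _, fun t ht x y => ?_⟩
  have h := (hC t x y ht).trans (le_max_left C 0)
  have h0 : (1 + x ^ 2) * (1 + y ^ 2) ≤ (1 + |x| + |y|) ^ 4 := by
    have h1 : 1 + x ^ 2 ≤ (1 + |x| + |y|) ^ 2 := by
      nlinarith [abs_nonneg x, abs_nonneg y, sq_abs x, mul_nonneg (abs_nonneg x) (abs_nonneg y)]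
    have h2 : 1 + y ^ 2 ≤ (1 + |x| + |y|) ^ 2 := by
      nlinarith [abs_nonneg x, abs_nonneg y, sq_abs y, mul_nonneg (abs_nonneg x) (abs_nonneg y)]
    calc (1 + x ^ 2) * (1 + y ^ 2) ≤ (1 + |x| + |y|) ^ 2 * (1 + |x| + |y|) ^ 2 := by gcongr
      _ = _ := by ring
  have h3 : (1 + x ^ 2) * (1 + y ^ 2) * |D2 u l t x y| ≤ max C 0 :=
    (mul_le_mul_of_nonneg_right h0 (abs_nonneg _)).trans h
  unfold bump
  rw [← mul_inv, ← div_eq_mul_inv, le_div_iff₀ (by positivity)]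
  linarith

lemma isBddCont_D2 (hu : IsAdmissibleZK2 u) (l : List (Fin 3)) {t : ℝ} (ht : 2 ≤ t) :
    IsBddCont fun p : ℝ × ℝ => D2 u l t p.1 p.2 := by
  obtain ⟨C, hC0, hC⟩ := hu.exists_abs_D2_le l t t ht
  refine ⟨continuous_D2_slice hu.smooth l t, C, fun p => (hC t ⟨le_rfl, le_rfl⟩ _ _).trans ?_⟩
  exact mul_le_of_le_one_right hC0 (mul_le_one₀ (bump_le_one _) (bump_pos _).le (bump_le_one _))

lemma integrable_D2_mul (hu : IsAdmissibleZK2 u) (l : List (Fin 3)) {t : ℝ} (ht : 2 ≤ t)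
    {W : ℝ × ℝ → ℝ} (hW : IsBddCont W) :
    Integrable fun p : ℝ × ℝ => D2 u l t p.1 p.2 * W p := by
  obtain ⟨C, hC0, hC⟩ := hu.exists_abs_D2_le l t t ht
  obtain ⟨hWc, K, hK⟩ := hW
  have hi : Integrable fun p : ℝ × ℝ => C * (bump (p.1 / 1) * bump (p.2 / 1)) * K :=
    ((integrable_bump_prod one_pos one_pos).const_mul C).mul_const K
  refine hi.mono' ((continuous_D2_slice hu.smooth l t).mul hWc).aestronglyMeasurable
    (Eventually.of_forall fun p => ?_)
  rw [Real.norm_eq_abs, abs_mul, div_one, div_one]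
  refine mul_le_mul (hC t ⟨le_rfl, le_rfl⟩ _ _) (hK p) (abs_nonneg _) ?_
  exact mul_nonneg hC0 (mul_nonneg (bump_pos _).le (bump_pos _).le)

lemma integrable_mul (hu : IsAdmissibleZK2 u) {t : ℝ} (ht : 2 ≤ t)
    {W : ℝ × ℝ → ℝ} (hW : IsBddCont W) : Integrable fun p : ℝ × ℝ => u t p.1 p.2 * W p :=
  hu.integrable_D2_mul [] ht hW

lemma integrable_sq_mul (hu : IsAdmissibleZK2 u) {t : ℝ} (ht : 2 ≤ t)
    {W : ℝ × ℝ → ℝ} (hW : IsBddCont W) : Integrable fun p : ℝ × ℝ => u t p.1 p.2 ^ 2 * W p := by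
  have := hu.integrable_mul ht ((hu.isBddCont_D2 [] ht).mul hW)
  refine this.congr (Eventually.of_forall fun p => ?_)
  simp only [D2]
  ring

lemma integrable_sq (hu : IsAdmissibleZK2 u) {t : ℝ} (ht : 2 ≤ t) :
    Integrable fun p : ℝ × ℝ => u t p.1 p.2 ^ 2 := by
  simpa using hu.integrable_sq_mul ht (W := fun _ => 1) ⟨continuous_const, 1, by simp⟩

/-- The equation with the dispersive term expanded. -/
lemma pt2_eq (hu : IsAdmissibleZK2 u) {t : ℝ} (ht : 2 ≤ t) (x y : ℝ) :
    pt2 u t x y = -(D2 u [1, 1, 1] t x y + D2 u [1, 2, 2] t x y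
      + u t x y * D2 u [1] t x y) := by
  have h := hu.eqn t x y ht
  have e : px2 (fun t' x' y' => px2 (px2 u) t' x' y' + py2 (py2 u) t' x' y') t x y
      = D2 u [1, 1, 1] t x y + D2 u [1, 2, 2] t x y :=
    ((hasDerivAt_px2 (contDiff_D2 hu.smooth [1, 1]) t x y).add
      (hasDerivAt_px2 (contDiff_D2 hu.smooth [2, 2]) t x y)).deriv
  rw [e] at h
  have e1 : D2 u [1] t x y = px2 u t x y := rfl
  rw [e1]
  linarith

/-- The weighted momentum identity for a product weight `f(x) g(y)`. -/
lemma integral_pt2_mul (hu : IsAdmissibleZK2 u) {t : ℝ} (ht : 2 ≤ t)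
    {f f₁ f₂ f₃ g g₁ g₂ : ℝ → ℝ}
    (hf : ∀ x, HasDerivAt f (f₁ x) x) (hf₁ : ∀ x, HasDerivAt f₁ (f₂ x) x)
    (hf₂ : ∀ x, HasDerivAt f₂ (f₃ x) x) (hg : ∀ x, HasDerivAt g (g₁ x) x)
    (hg₁ : ∀ x, HasDerivAt g₁ (g₂ x) x)
    (bf : IsBddCont f) (bf₁ : IsBddCont f₁) (bf₂ : IsBddCont f₂) (bf₃ : IsBddCont f₃)
    (bg : IsBddCont g) (bg₁ : IsBddCont g₁) (bg₂ : IsBddCont g₂) :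
    ∫ p : ℝ × ℝ, pt2 u t p.1 p.2 * (f p.1 * g p.2)
      = (∫ p : ℝ × ℝ, u t p.1 p.2 * (f₃ p.1 * g p.2))
        + (∫ p : ℝ × ℝ, u t p.1 p.2 * (f₁ p.1 * g₂ p.2))
        + 1 / 2 * ∫ p : ℝ × ℝ, u t p.1 p.2 ^ 2 * (f₁ p.1 * g p.2) := by
  have dx := fun l (p : ℝ × ℝ) => hasDerivAt_px2 (contDiff_D2 hu.smooth l) t p.1 p.2
  have dy := fun l (p : ℝ × ℝ) => hasDerivAt_py2 (contDiff_D2 hu.smooth l) t p.1 p.2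
  have I := fun l (W : ℝ × ℝ → ℝ) (hW : IsBddCont W) => hu.integrable_D2_mul l ht hW
  have I2 := fun l (W : ℝ × ℝ → ℝ) (hW : IsBddCont W) =>
    hu.integrable_D2_mul l ht ((hu.isBddCont_D2 [] ht).mul hW)
  have wfg := bf.fst.mul bg.snd
  have wf₁g := bf₁.fst.mul bg.snd
  have wf₂g := bf₂.fst.mul bg.snd
  have wf₃g := bf₃.fst.mul bg.snd
  have wf₁g₁ := bf₁.fst.mul bg₁.snd
  have wf₁g₂ := bf₁.fst.mul bg₂.snd
  obtain ⟨P, hP⟩ : ∃ P : ℝ × ℝ → ℝ, P = fun p => D2 u [1, 1, 1] t p.1 p.2 * (f p.1 * g p.2)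
      + D2 u [1] t p.1 p.2 * (D2 u [] t p.1 p.2 * (f p.1 * g p.2))
      + D2 u [] t p.1 p.2 * (f₃ p.1 * g p.2)
      + 1 / 2 * (D2 u [] t p.1 p.2 * (D2 u [] t p.1 p.2 * (f₁ p.1 * g p.2)))
      + D2 u [1, 2, 2] t p.1 p.2 * (f p.1 * g p.2) := ⟨_, rfl⟩
  have iP : Integrable P := by
    rw [hP]
    exact (((((I _ _ wfg).add (I2 _ _ wfg)).add (I _ _ wf₃g)).add ((I2 _ _ wf₁g).const_mul _)).add
      (I _ _ wfg))
  have hx : ∫ p : ℝ × ℝ, (P p + D2 u [2, 2] t p.1 p.2 * (f₁ p.1 * g p.2)) = 0 := by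
    refine integral_eq_zero_of_hasLineDerivAt (v := (1, 0))
      (F := fun p : ℝ × ℝ => D2 u [1, 1] t p.1 p.2 * (f p.1 * g p.2)
        + 1 / 2 * (D2 u [] t p.1 p.2 * (D2 u [] t p.1 p.2 * (f p.1 * g p.2)))
        - D2 u [1] t p.1 p.2 * (f₁ p.1 * g p.2) + D2 u [] t p.1 p.2 * (f₂ p.1 * g p.2)
        + D2 u [2, 2] t p.1 p.2 * (f p.1 * g p.2))
      (((((I _ _ wfg).add ((I2 _ _ wfg).const_mul _)).sub (I _ _ wf₁g)).add (I _ _ wf₂g)).add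
        (I _ _ wfg))
      (iP.add (I _ _ wf₁g)) (fun p => hasLineDerivAt_fst ?_)
    have F0 := (hf p.1).mul_const (g p.2)
    have F1 := (hf₁ p.1).mul_const (g p.2)
    have F2 := (hf₂ p.1).mul_const (g p.2)
    have := (((((dx [1, 1] p).mul F0).add
      (((dx [] p).mul ((dx [] p).mul F0)).const_mul (1 / 2))).sub ((dx [1] p).mul F1)).add
        ((dx [] p).mul F2)).add ((dx [2, 2] p).mul F0)
    refine this.congr_deriv ?_
    simp only [hP, D2, Pi.mul_apply]
    simp
    ring
  have hy : ∫ p : ℝ × ℝ, (D2 u [2, 2] t p.1 p.2 * (f₁ p.1 * g p.2)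
      - D2 u [] t p.1 p.2 * (f₁ p.1 * g₂ p.2)) = 0 := by
    refine integral_eq_zero_of_hasLineDerivAt (v := (0, 1))
      (F := fun p : ℝ × ℝ => D2 u [2] t p.1 p.2 * (f₁ p.1 * g p.2)
        - D2 u [] t p.1 p.2 * (f₁ p.1 * g₁ p.2))
      ((I _ _ wf₁g).sub (I _ _ wf₁g₁)) ((I _ _ wf₁g).sub (I _ _ wf₁g₂))
      (fun p => hasLineDerivAt_snd ?_)
    have := ((dy [2] p).mul ((hg p.2).const_mul (f₁ p.1))).sub
      ((dy [] p).mul ((hg₁ p.2).const_mul (f₁ p.1)))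
    refine this.congr_deriv ?_
    simp only [D2]
    simp
    ring
  rw [integral_add iP (I _ _ wf₁g)] at hx
  rw [integral_sub (I _ _ wf₁g) (I _ _ wf₁g₂)] at hy
  have hz : ∫ p : ℝ × ℝ, pt2 u t p.1 p.2 * (f p.1 * g p.2)
      = ∫ p : ℝ × ℝ, (-P p + u t p.1 p.2 * (f₃ p.1 * g p.2)
        + 1 / 2 * (u t p.1 p.2 ^ 2 * (f₁ p.1 * g p.2))) := by
    refine integral_congr_ae (Eventually.of_forall fun p => ?_)
    simp only [hu.pt2_eq ht, hP]
    rw [show D2 u [] = u from rfl]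
    ring
  have iR : Integrable fun p : ℝ × ℝ => -P p + u t p.1 p.2 * (f₃ p.1 * g p.2) :=
    iP.neg.add (hu.integrable_mul ht wf₃g)
  have iN : Integrable fun p => -P p := iP.neg
  rw [hz, integral_add iR ((hu.integrable_sq_mul ht wf₁g).const_mul _),
    integral_add iN (hu.integrable_mul ht wf₃g), integral_neg, integral_const_mul]
  have hy' : ∫ p : ℝ × ℝ, D2 u [] t p.1 p.2 * (f₁ p.1 * g₂ p.2)
    = ∫ p : ℝ × ℝ, u t p.1 p.2 * (f₁ p.1 * g₂ p.2) := rfl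
  linarith

lemma hasDerivAt_integral_mul (hu : IsAdmissibleZK2 u) {t : ℝ} (ht : 2 < t)
    {W : ℝ × ℝ → ℝ} (hW : IsBddCont W) :
    HasDerivAt (fun s => ∫ p : ℝ × ℝ, u s p.1 p.2 * W p)
      (∫ p : ℝ × ℝ, pt2 u t p.1 p.2 * W p) t := by
  obtain ⟨C, hC0, hC⟩ := hu.exists_abs_D2_le [0] 2 (t + 1) le_rfl
  obtain ⟨hWc, K, hK⟩ := id hW
  have hi : Integrable fun p : ℝ × ℝ => C * (bump (p.1 / 1) * bump (p.2 / 1)) * K :=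
    ((integrable_bump_prod one_pos one_pos).const_mul C).mul_const K
  refine (hasDerivAt_integral_of_dominated_loc_of_deriv_le
    (F := fun s (p : ℝ × ℝ) => u s p.1 p.2 * W p)
    (F' := fun s (p : ℝ × ℝ) => pt2 u s p.1 p.2 * W p)
    (Icc_mem_nhds ht (lt_add_one t))
    (Eventually.of_forall fun s =>
      ((continuous_D2_slice hu.smooth [] s).mul hWc).aestronglyMeasurable)
    (hu.integrable_mul ht.le hW)
    ((continuous_D2_slice hu.smooth [0] t).mul hWc).aestronglyMeasurable
    (Eventually.of_forall fun p s hs => ?_) hi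
    (Eventually.of_forall fun p s _ => ?_)).2
  · rw [Real.norm_eq_abs, abs_mul, div_one, div_one]
    refine mul_le_mul (hC s hs _ _) (hK p) (abs_nonneg _) ?_
    exact mul_nonneg hC0 (mul_nonneg (bump_pos _).le (bump_pos _).le)
  · exact (hasDerivAt_pt2 hu.smooth s p.1 p.2).mul_const (W p)

end IsAdmissibleZK2

/-- The open rectangle `{|x| < a, |y| < B}`. -/
def rect (a B : ℝ) : Set (ℝ × ℝ) := {q | |q.1| < a ∧ |q.2| < B}

lemma measurableSet_rect (a B : ℝ) : MeasurableSet (rect a B) :=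
  ((isOpen_lt continuous_fst.abs continuous_const).inter
    (isOpen_lt continuous_snd.abs continuous_const)).measurableSet

lemma half_le_bump_div {a x : ℝ} (h : |x| < a) : 1 / 2 ≤ bump (x / a) := by
  have ha : 0 < a := (abs_nonneg x).trans_lt h
  have h1 : (x / a) ^ 2 ≤ 1 := by
    rw [sq_le_one_iff_abs_le_one, abs_div, abs_of_pos ha]
    exact (div_le_one ha).2 h.le
  unfold bump
  rw [one_div]
  exact inv_anti₀ (by positivity) (by linarith)

lemma HasDerivAt.comp_div_const {f f' : ℝ → ℝ} (h : ∀ z, HasDerivAt f (f' z) z) (a x : ℝ) :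
    HasDerivAt (fun z => f (z / a)) (f' (x / a) / a) x := by
  have := (h (x / a)).comp x ((hasDerivAt_id x).div_const a)
  simpa [Function.comp_def, div_eq_mul_inv] using this

lemma IsBddCont.comp_div {f : ℝ → ℝ} (h : IsBddCont f) (a : ℝ) : IsBddCont fun z => f (z / a) :=
  h.comp (continuous_id.div_const a)

namespace IsAdmissibleZK2

variable {u : ℝ → ℝ → ℝ → ℝ}

lemma abs_integral_mul_le_of_sq_le (hu : IsAdmissibleZK2 u) {t C : ℝ} (ht : 2 ≤ t)
    (hC : ∫ p : ℝ × ℝ, u t p.1 p.2 ^ 2 ≤ C) {W : ℝ × ℝ → ℝ} (hW : Continuous W)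
    {a A B α β M : ℝ} (ha : 0 < a) (hA : 0 < A) (hB : 0 < B) (hα : 0 ≤ α) (hβ : 0 ≤ β)
    (hM : 0 < M)
    (h : ∀ p, W p ^ 2 ≤ (α * bump (p.1 / a) + β * bump (p.1 / A)) * bump (p.2 / B))
    (hαβ : 10 * (α * a * B + β * A * B) ≤ M ^ 2) :
    |∫ p : ℝ × ℝ, u t p.1 p.2 * W p| ≤ M * (C + 1) := by
  have i1 := (integrable_bump_prod ha hB).const_mul α
  have i2 := (integrable_bump_prod hA hB).const_mul β
  have hle : ∀ p, W p ^ 2 ≤ α * (bump (p.1 / a) * bump (p.2 / B))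
      + β * (bump (p.1 / A) * bump (p.2 / B)) := fun p => (h p).trans_eq (by ring)
  have iW : Integrable fun p => W p ^ 2 :=
    (i1.add i2).mono' (hW.pow 2).aestronglyMeasurable
      (Eventually.of_forall fun p => by
        rw [Real.norm_eq_abs, abs_of_nonneg (sq_nonneg _)]; exact hle p)
  refine abs_integral_mul_le hM (hu.integrable_sq ht) iW hC ?_
  have h1 := integral_mono iW (i1.add i2) hle
  have h2 : ∫ p, W p ^ 2 ≤ α * (Real.pi ^ 2 * (a * B)) + β * (Real.pi ^ 2 * (A * B)) := by
    refine h1.trans_eq ?_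
    simp only [Pi.add_apply]
    rw [integral_add i1 i2, integral_const_mul, integral_const_mul, integral_bump_prod ha hB,
      integral_bump_prod hA hB]
  have hpi : Real.pi ^ 2 ≤ 10 := by nlinarith [Real.pi_lt_d2, Real.pi_pos]
  have h3 : 0 ≤ α * a * B + β * A * B := by positivity
  nlinarith [mul_le_mul_of_nonneg_right hpi h3]

lemma measurable_integral_rect (hu : IsAdmissibleZK2 u) (a B : ℝ) :
    StronglyMeasurable fun t => ∫ p in rect a B, u t p.1 p.2 ^ 2 := by
  have hc : Continuous fun z : ℝ × (ℝ × ℝ) => u z.1 z.2.1 z.2.2 ^ 2 :=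
    hu.smooth.continuous.pow 2
  exact hc.stronglyMeasurable.integral_prod_right'

lemma integral_rect_le (hu : IsAdmissibleZK2 u) {t : ℝ} (ht : 2 ≤ t) (a B : ℝ) :
    ∫ p in rect a B, u t p.1 p.2 ^ 2 ≤ ∫ p : ℝ × ℝ, u t p.1 p.2 ^ 2 :=
  setIntegral_le_integral (hu.integrable_sq ht) (Eventually.of_forall fun _ => sq_nonneg _)

lemma integrableOn_integral_rect (hu : IsAdmissibleZK2 u) {T S C : ℝ} (hT : 2 ≤ T)
    (hC : ∀ t, 2 ≤ t → ∫ p : ℝ × ℝ, u t p.1 p.2 ^ 2 ≤ C) (a B : ℝ) :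
    IntegrableOn (fun t => ∫ p in rect a B, u t p.1 p.2 ^ 2) (Set.Icc T S) := by
  refine Measure.integrableOn_of_bounded (M := C) (by simp)
    (hu.measurable_integral_rect a B).aestronglyMeasurable ?_
  refine (ae_restrict_iff' measurableSet_Icc).2 (Eventually.of_forall fun t ht => ?_)
  rw [Real.norm_eq_abs, abs_of_nonneg (integral_nonneg fun _ => sq_nonneg _)]
  exact (hu.integral_rect_le (hT.trans ht.1) a B).trans (hC t (hT.trans ht.1))

lemma integral_sq_mul_bump_le (hu : IsAdmissibleZK2 u) {t : ℝ} (ht : 2 ≤ t) (A B : ℝ) :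
    ∫ p : ℝ × ℝ, u t p.1 p.2 ^ 2 * (bump (p.1 / A) * bump (p.2 / B))
      ≤ ∫ p : ℝ × ℝ, u t p.1 p.2 ^ 2 := by
  refine integral_mono (hu.integrable_sq_mul ht
    ((isBddCont_bump.comp_div A).fst.mul (isBddCont_bump.comp_div B).snd))
    (hu.integrable_sq ht) fun p => ?_
  exact mul_le_of_le_one_right (sq_nonneg _)
    (mul_le_one₀ (bump_le_one _) (bump_pos _).le (bump_le_one _))

lemma integral_rect_le_four_mul (hu : IsAdmissibleZK2 u) {t : ℝ} (ht : 2 ≤ t) (a B : ℝ) :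
    ∫ p in rect a B, u t p.1 p.2 ^ 2
      ≤ 4 * ∫ p : ℝ × ℝ, u t p.1 p.2 ^ 2 * (bump (p.1 / a) * bump (p.2 / B)) := by
  have hi := (hu.integrable_sq_mul ht
    ((isBddCont_bump.comp_div a).fst.mul (isBddCont_bump.comp_div B).snd)).const_mul 4
  have h0 : ∀ p : ℝ × ℝ, 0 ≤ 4 * (u t p.1 p.2 ^ 2 * (bump (p.1 / a) * bump (p.2 / B))) :=
    fun p => by
      have := bump_pos (p.1 / a)
      have := bump_pos (p.2 / B)
      positivity
  rw [← integral_const_mul]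
  refine le_trans ?_ (setIntegral_le_integral (s := rect a B) hi (Eventually.of_forall h0))
  refine setIntegral_mono_on (hu.integrable_sq ht).integrableOn hi.integrableOn
    (measurableSet_rect a B) fun p hp => ?_
  have h1 := half_le_bump_div hp.1
  have h2 := half_le_bump_div hp.2
  have h3 : 1 ≤ 4 * (bump (p.1 / a) * bump (p.2 / B)) := by nlinarith
  nlinarith [sq_nonneg (u t p.1 p.2)]

/-- Averaged `L²` bound on a fixed rectangle over a time interval. -/
lemma integral_integral_rect_le (hu : IsAdmissibleZK2 u) {T S C : ℝ} (hT : 2 < T) (hTS : T ≤ S)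
    (hC : ∀ t, 2 ≤ t → ∫ p : ℝ × ℝ, u t p.1 p.2 ^ 2 ≤ C)
    {a A B M₀ M₁ M₂ : ℝ} (ha : 0 < a) (haA : a ≤ A) (hB : 0 < B)
    (hM₀ : 0 < M₀) (hM₁ : 0 < M₁) (hM₂ : 0 < M₂)
    (h₀ : 64 * (A * B) ≤ M₀ ^ 2) (h₁ : 1600 * (B / a ^ 5) ≤ M₁ ^ 2)
    (h₂ : 1600 / (a * B ^ 3) ≤ M₂ ^ 2) :
    ∫ t in T..S, ∫ p in rect a B, u t p.1 p.2 ^ 2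
      ≤ 8 * a * (2 * (M₀ * (C + 1)) + (S - T) * ((M₁ + M₂) * (C + 1) + C / (2 * A))) := by
  have hA : 0 < A := ha.trans_le haA
  set f : ℝ → ℝ := fun x => Real.arctan (x / a) - Real.arctan (x / A) with hf
  set f₁ : ℝ → ℝ := fun x => bump (x / a) / a - bump (x / A) / A with hf₁
  set f₂ : ℝ → ℝ := fun x => bump₁ (x / a) / a / a - bump₁ (x / A) / A / A with hf₂
  set f₃ : ℝ → ℝ := fun x => bump₂ (x / a) / a / a / a - bump₂ (x / A) / A / A / A with hf₃
  set g : ℝ → ℝ := fun y => bump (y / B) with hg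
  set g₁ : ℝ → ℝ := fun y => bump₁ (y / B) / B with hg₁
  set g₂ : ℝ → ℝ := fun y => bump₂ (y / B) / B / B with hg₂
  have hatan : ∀ z, HasDerivAt Real.arctan (bump z) z := fun z => by
    simpa [bump] using Real.hasDerivAt_arctan z
  have df : ∀ x, HasDerivAt f (f₁ x) x := fun x =>
    (HasDerivAt.comp_div_const hatan a x).sub (HasDerivAt.comp_div_const hatan A x)
  have df₁ : ∀ x, HasDerivAt f₁ (f₂ x) x := fun x =>
    ((HasDerivAt.comp_div_const hasDerivAt_bump a x).div_const a).sub
      ((HasDerivAt.comp_div_const hasDerivAt_bump A x).div_const A)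
  have df₂ : ∀ x, HasDerivAt f₂ (f₃ x) x := fun x =>
    (((HasDerivAt.comp_div_const hasDerivAt_bump₁ a x).div_const a).div_const a).sub
      (((HasDerivAt.comp_div_const hasDerivAt_bump₁ A x).div_const A).div_const A)
  have dg : ∀ x, HasDerivAt g (g₁ x) x := HasDerivAt.comp_div_const hasDerivAt_bump B
  have dg₁ : ∀ x, HasDerivAt g₁ (g₂ x) x := fun x =>
    (HasDerivAt.comp_div_const hasDerivAt_bump₁ B x).div_const B
  have bf : IsBddCont f := (isBddCont_arctan.comp_div a).sub (isBddCont_arctan.comp_div A)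
  have bf₁ : IsBddCont f₁ := ((isBddCont_bump.comp_div a).div_const a).sub
    ((isBddCont_bump.comp_div A).div_const A)
  have bf₂ : IsBddCont f₂ := (((isBddCont_bump₁.comp_div a).div_const a).div_const a).sub
    (((isBddCont_bump₁.comp_div A).div_const A).div_const A)
  have bf₃ : IsBddCont f₃ :=
    ((((isBddCont_bump₂.comp_div a).div_const a).div_const a).div_const a).sub
      ((((isBddCont_bump₂.comp_div A).div_const A).div_const A).div_const A)
  have bg : IsBddCont g := isBddCont_bump.comp_div B
  have bg₁ : IsBddCont g₁ := (isBddCont_bump₁.comp_div B).div_const B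
  have bg₂ : IsBddCont g₂ := ((isBddCont_bump₂.comp_div B).div_const B).div_const B
  have hw : IsBddCont fun p : ℝ × ℝ => f p.1 * g p.2 := bf.fst.mul bg.snd
  have e₀ : ∀ t, 2 ≤ t → |∫ p : ℝ × ℝ, u t p.1 p.2 * (f p.1 * g p.2)| ≤ M₀ * (C + 1) := by
    intro t ht
    refine hu.abs_integral_mul_le_of_sq_le ht (hC t ht) hw.1 (α := 0) (β := 5) ha hA hB
      le_rfl (by norm_num) hM₀ (fun p => ?_) (by nlinarith [mul_pos hA hB])
    have q1 := sq_arctan_sub_arctan_div_le ha haA p.1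
    have q2 := bump_pos (p.2 / B)
    have q3 := bump_le_one (p.2 / B)
    rw [mul_pow, zero_mul, zero_add]
    exact mul_le_mul q1 (by simp only [hg]; nlinarith) (sq_nonneg _)
      (by have := bump_pos (p.1 / A); positivity)
  have e₁ : ∀ t, 2 ≤ t → |∫ p : ℝ × ℝ, u t p.1 p.2 * (f₃ p.1 * g p.2)| ≤ M₁ * (C + 1) := by
    intro t ht
    refine hu.abs_integral_mul_le_of_sq_le ht (hC t ht) (bf₃.fst.mul bg.snd).1
      (α := 72 / a ^ 6) (β := 72 / A ^ 6) ha hA hB (by positivity) (by positivity) hM₁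
      (fun p => ?_) (le_trans ?_ h₁)
    · have q2 := bump_pos (p.2 / B)
      have q3 := bump_le_one (p.2 / B)
      have q4 : f₃ p.1 ^ 2 ≤ 72 / a ^ 6 * bump (p.1 / a) + 72 / A ^ 6 * bump (p.1 / A) := by
        have r1 := bump₂_sq_le (p.1 / a)
        have r2 := bump₂_sq_le (p.1 / A)
        have r3 : f₃ p.1 ^ 2 ≤ 2 * (bump₂ (p.1 / a) ^ 2 / a ^ 6)
            + 2 * (bump₂ (p.1 / A) ^ 2 / A ^ 6) := by
          have : ∀ v w : ℝ, (v - w) ^ 2 ≤ 2 * v ^ 2 + 2 * w ^ 2 := fun v w => by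
            nlinarith [sq_nonneg (v + w)]
          refine (this _ _).trans_eq ?_
          field_simp
        have r4 : bump₂ (p.1 / a) ^ 2 / a ^ 6 ≤ 36 * bump (p.1 / a) / a ^ 6 := by gcongr
        have r5 : bump₂ (p.1 / A) ^ 2 / A ^ 6 ≤ 36 * bump (p.1 / A) / A ^ 6 := by gcongr
        calc _ ≤ _ := r3
          _ ≤ 2 * (36 * bump (p.1 / a) / a ^ 6) + 2 * (36 * bump (p.1 / A) / A ^ 6) := by
            linarith
          _ = _ := by ring
      rw [mul_pow]
      exact mul_le_mul q4 (by simp only [hg]; nlinarith) (sq_nonneg _)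
        ((sq_nonneg _).trans q4)
    · have s1 : 72 / A ^ 6 * A * B ≤ 72 / a ^ 6 * a * B := by
        have t1 : 72 / A ^ 6 * A * B = 72 * (B / A ^ 5) := by field_simp
        have t2 : 72 / a ^ 6 * a * B = 72 * (B / a ^ 5) := by field_simp
        rw [t1, t2]
        gcongr
      have t2 : 72 / a ^ 6 * a * B = 72 * (B / a ^ 5) := by field_simp
      have t3 : 0 < B / a ^ 5 := by positivity
      linarith
  have e₂ : ∀ t, 2 ≤ t → |∫ p : ℝ × ℝ, u t p.1 p.2 * (f₁ p.1 * g₂ p.2)| ≤ M₂ * (C + 1) := by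
    intro t ht
    refine hu.abs_integral_mul_le_of_sq_le ht (hC t ht) (bf₁.fst.mul bg₂.snd).1
      (α := 72 / (a ^ 2 * B ^ 4)) (β := 72 / (A ^ 2 * B ^ 4)) ha hA hB (by positivity)
      (by positivity) hM₂ (fun p => ?_) (le_trans ?_ h₂)
    · have q2 : g₂ p.2 ^ 2 ≤ 36 * bump (p.2 / B) / B ^ 4 := by
        have : g₂ p.2 ^ 2 = bump₂ (p.2 / B) ^ 2 / B ^ 4 := by
          simp only [hg₂]; field_simp
        rw [this]
        have := bump₂_sq_le (p.2 / B)
        gcongr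
      have q4 : f₁ p.1 ^ 2 ≤ 2 / a ^ 2 * bump (p.1 / a) + 2 / A ^ 2 * bump (p.1 / A) := by
        have r0 : ∀ z, bump z ^ 2 ≤ bump z := fun z => by
          nlinarith [bump_pos z, bump_le_one z]
        have r3 : f₁ p.1 ^ 2 ≤ 2 * (bump (p.1 / a) ^ 2 / a ^ 2)
            + 2 * (bump (p.1 / A) ^ 2 / A ^ 2) := by
          have : ∀ v w : ℝ, (v - w) ^ 2 ≤ 2 * v ^ 2 + 2 * w ^ 2 := fun v w => by
            nlinarith [sq_nonneg (v + w)]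
          refine (this _ _).trans_eq ?_
          field_simp
        have r4 : bump (p.1 / a) ^ 2 / a ^ 2 ≤ bump (p.1 / a) / a ^ 2 := by gcongr; exact r0 _
        have r5 : bump (p.1 / A) ^ 2 / A ^ 2 ≤ bump (p.1 / A) / A ^ 2 := by gcongr; exact r0 _
        calc _ ≤ _ := r3
          _ ≤ 2 * (bump (p.1 / a) / a ^ 2) + 2 * (bump (p.1 / A) / A ^ 2) := by linarith
          _ = _ := by ring
      rw [mul_pow]
      refine (mul_le_mul q4 q2 (sq_nonneg _) ((sq_nonneg _).trans q4)).trans_eq ?_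
      field_simp
      ring
    · have t1 : 72 / (A ^ 2 * B ^ 4) * A * B = 72 / (A * B ^ 3) := by field_simp
      have t2 : 72 / (a ^ 2 * B ^ 4) * a * B = 72 / (a * B ^ 3) := by field_simp
      have s1 : 72 / (A * B ^ 3) ≤ 72 / (a * B ^ 3) := by gcongr
      rw [t1, t2]
      calc 10 * (72 / (a * B ^ 3) + 72 / (A * B ^ 3)) ≤ 1440 / (a * B ^ 3) := by
            have : 1440 / (a * B ^ 3) = 20 * (72 / (a * B ^ 3)) := by ring
            linarith
        _ ≤ 1600 / (a * B ^ 3) := by gcongr; norm_num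
  set R := (M₁ + M₂) * (C + 1) + C / (2 * A) with hR
  set E : ℝ → ℝ := fun t => ∫ p in rect a B, u t p.1 p.2 ^ 2 with hE
  have iE : IntegrableOn E (Set.Icc T S) := hu.integrableOn_integral_rect hT.le hC a B
  have key : ∫ t in T..S, (E t / (8 * a) - R)
      ≤ (∫ p : ℝ × ℝ, u S p.1 p.2 * (f p.1 * g p.2))
        - ∫ p : ℝ × ℝ, u T p.1 p.2 * (f p.1 * g p.2) := by
    refine intervalIntegral.integral_le_sub_of_hasDeriv_right_of_le
      (g := fun t => ∫ p : ℝ × ℝ, u t p.1 p.2 * (f p.1 * g p.2))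
      (g' := fun t => ∫ p : ℝ × ℝ, pt2 u t p.1 p.2 * (f p.1 * g p.2)) hTS
      (fun t ht => (hu.hasDerivAt_integral_mul (hT.trans_le ht.1) hw).continuousAt.continuousWithinAt)
      (fun t ht => (hu.hasDerivAt_integral_mul (hT.trans ht.1) hw).hasDerivWithinAt)
      ((iE.div_const _).sub (integrableOn_const (by simp))) fun t ht => ?_
    have ht2 : 2 ≤ t := (hT.trans ht.1).le
    simp only [hu.integral_pt2_mul ht2 df df₁ df₂ dg dg₁ bf bf₁ bf₂ bf₃ bg bg₁ bg₂]
    have b1 := (abs_le.1 (e₁ t ht2)).1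
    have b2 := (abs_le.1 (e₂ t ht2)).1
    have ia := hu.integrable_sq_mul ht2
      ((isBddCont_bump.comp_div a).fst.mul (isBddCont_bump.comp_div B).snd)
    have iA := hu.integrable_sq_mul ht2
      ((isBddCont_bump.comp_div A).fst.mul (isBddCont_bump.comp_div B).snd)
    have b3 : ∫ p : ℝ × ℝ, u t p.1 p.2 ^ 2 * (f₁ p.1 * g p.2)
        = a⁻¹ * (∫ p : ℝ × ℝ, u t p.1 p.2 ^ 2 * (bump (p.1 / a) * bump (p.2 / B)))
          - A⁻¹ * ∫ p : ℝ × ℝ, u t p.1 p.2 ^ 2 * (bump (p.1 / A) * bump (p.2 / B)) := by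
      rw [← integral_const_mul, ← integral_const_mul,
        ← integral_sub (ia.const_mul _) (iA.const_mul _)]
      refine integral_congr_ae (Eventually.of_forall fun p => ?_)
      simp only [hf₁, hg]
      ring
    have b4 : E t / 4 ≤ ∫ p : ℝ × ℝ, u t p.1 p.2 ^ 2 * (bump (p.1 / a) * bump (p.2 / B)) := by
      have := hu.integral_rect_le_four_mul ht2 a B
      simp only [hE]
      linarith
    have b5 := (hu.integral_sq_mul_bump_le ht2 A B).trans (hC t ht2)
    have b6 := mul_le_mul_of_nonneg_left b4 (inv_nonneg.2 ha.le)
    have b7 := mul_le_mul_of_nonneg_left b5 (inv_nonneg.2 hA.le)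
    rw [b3]
    have b8 : E t / (8 * a) = 1 / 2 * (a⁻¹ * (E t / 4)) := by field_simp; ring
    have b9 : C / (2 * A) = 1 / 2 * (A⁻¹ * C) := by field_simp
    rw [hR, b8, b9]
    linarith
  have iE' : IntervalIntegrable E volume T S :=
    (intervalIntegrable_iff_integrableOn_Icc_of_le hTS).2 iE
  rw [intervalIntegral.integral_sub (iE'.div_const _) intervalIntegrable_const,
    intervalIntegral.integral_div, intervalIntegral.integral_const, smul_eq_mul] at key
  have c1 := (abs_le.1 (e₀ S (hT.le.trans hTS))).2
  have c2 := (abs_le.1 (e₀ T hT.le)).1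
  have c3 : (∫ t in T..S, E t) / (8 * a) ≤ 2 * (M₀ * (C + 1)) + (S - T) * R := by linarith
  rw [div_le_iff₀ (by positivity)] at c3
  linarith

end IsAdmissibleZK2

lemma summable_dyadic_rpow {e : ℝ} (he : e < 0) :
    Summable fun k : ℕ => (2 * (10 * (2 : ℝ) ^ k)) ^ e := by
  have h : ∀ k : ℕ, (2 * (10 * (2 : ℝ) ^ k)) ^ e = 20 ^ e * ((2 : ℝ) ^ e) ^ k := fun k => by
    rw [← mul_assoc, Real.mul_rpow (by norm_num) (by positivity), ← Real.rpow_natCast,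
      ← Real.rpow_natCast, ← Real.rpow_mul (by norm_num), ← Real.rpow_mul (by norm_num),
      mul_comm e]
    norm_num
  simp only [h]
  exact (summable_geometric_of_lt_one (by positivity)
    (Real.rpow_lt_one_of_one_lt_of_neg one_lt_two he)).mul_left _

lemma one_le_log_of_ten_le {t : ℝ} (ht : 10 ≤ t) : 1 ≤ Real.log t := by
  rw [Real.le_log_iff_exp_le (by linarith)]
  linarith [Real.exp_one_lt_three]

lemma Ici_ten_subset_iUnion_dyadic :
    Set.Ici (10 : ℝ) ⊆ ⋃ k : ℕ, Set.Icc (10 * (2 : ℝ) ^ k) (2 * (10 * (2 : ℝ) ^ k)) := by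
  intro t ht
  have ht' : (10 : ℝ) ≤ t := ht
  obtain ⟨k, hk₁, hk₂⟩ := exists_nat_pow_near (show 1 ≤ t / 10 by linarith) one_lt_two
  rw [pow_succ] at hk₂
  exact Set.mem_iUnion.2 ⟨k, by linarith, by linarith⟩

namespace IsAdmissibleZK2

variable {u : ℝ → ℝ → ℝ → ℝ}

/-- The weighted local `L²` norm over `[T, 2T]`, with an auxiliary exponent `q > 1`. -/
lemma lintegral_dyadic_le (hu : IsAdmissibleZK2 u) {r b q C T : ℝ} (hb : 0 < b) (hr : 0 < r)
    (hq : 1 ≤ q) (hC : ∀ t, 2 ≤ t → ∫ p : ℝ × ℝ, u t p.1 p.2 ^ 2 ≤ C) (hT : 10 ≤ T) :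
    ∫⁻ t in Set.Icc T (2 * T), ENNReal.ofReal ((1 / (t * Real.log t)) *
        ∫ p in rect (t ^ b) (t ^ (b * r)), u t p.1 p.2 ^ 2)
      ≤ ENNReal.ofReal ((C + 1) * (256 * (2 * T) ^ (b + b * (q + r) / 2 - 1)
        + 320 * (2 * T) ^ (b * (r - 3) / 2) + 320 * (2 * T) ^ (b * (1 - 3 * r) / 2)
        + 4 * (2 * T) ^ (b * (1 - q)))) := by
  have hT0 : 0 < T := by linarith
  obtain ⟨S, hS⟩ : ∃ S, S = 2 * T := ⟨_, rfl⟩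
  rw [← hS]
  have hS0 : 0 < S := by linarith
  have hS1 : 1 ≤ S := by linarith
  have hTS : T ≤ S := by linarith
  have hC0 : 0 ≤ C := (integral_nonneg fun _ => sq_nonneg _).trans (hC 2 le_rfl)
  have hpow : ∀ (s : ℝ) (n : ℕ), (S ^ s) ^ n = S ^ (s * n) := fun s n => by
    rw [Real.rpow_mul hS0.le, Real.rpow_natCast]
  set E : ℝ → ℝ := fun t => ∫ p in rect (S ^ b) (S ^ (b * r)), u t p.1 p.2 ^ 2 with hE
  have main := hu.integral_integral_rect_le (T := T) (S := S) (C := C) (by linarith) hTS hC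
    (a := S ^ b) (A := S ^ (b * q)) (B := S ^ (b * r)) (M₀ := 8 * S ^ (b * (q + r) / 2))
    (M₁ := 40 * S ^ (b * (r - 5) / 2)) (M₂ := 40 * S ^ (-(b * (1 + 3 * r) / 2)))
    (by positivity) (Real.rpow_le_rpow_of_exponent_le hS1 (by nlinarith)) (by positivity)
    (by positivity) (by positivity) (by positivity)
    (by
      rw [mul_pow, hpow, ← Real.rpow_add hS0]
      refine le_of_eq ?_
      norm_num
      ring_nf)
    (by
      rw [mul_pow, hpow, hpow, ← Real.rpow_sub hS0]
      refine le_of_eq ?_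
      norm_num
      ring_nf)
    (by
      rw [mul_pow, hpow, hpow, ← Real.rpow_add hS0, div_eq_mul_inv, ← Real.rpow_neg hS0.le]
      refine le_of_eq ?_
      norm_num
      ring_nf)
  have iE : IntegrableOn E (Set.Icc T S) :=
    hu.integrableOn_integral_rect (by linarith) hC _ _
  have hE0 : ∀ t, 0 ≤ E t := fun t => integral_nonneg fun _ => sq_nonneg _
  have hle : ∀ t ∈ Set.Icc T S, (1 / (t * Real.log t)) *
      ∫ p in rect (t ^ b) (t ^ (b * r)), u t p.1 p.2 ^ 2 ≤ T⁻¹ * E t := by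
    intro t ht
    have ht0 : 0 < t := hT0.trans_le ht.1
    have hlog := one_le_log_of_ten_le (hT.trans ht.1)
    have hmono : ∫ p in rect (t ^ b) (t ^ (b * r)), u t p.1 p.2 ^ 2 ≤ E t := by
      refine setIntegral_mono_set (hu.integrable_sq (by linarith [ht.1])).integrableOn
        (Eventually.of_forall fun _ => sq_nonneg _) (Eventually.of_forall fun p hp => ?_)
      exact ⟨hp.1.trans_le (Real.rpow_le_rpow ht0.le ht.2 hb.le),
        hp.2.trans_le (Real.rpow_le_rpow ht0.le ht.2 (by positivity))⟩
    refine mul_le_mul ?_ hmono (integral_nonneg fun _ => sq_nonneg _) (by positivity)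
    rw [one_div]
    exact inv_anti₀ hT0 (ht.1.trans (le_mul_of_one_le_right ht0.le hlog))
  calc _ ≤ ∫⁻ t in Set.Icc T S, ENNReal.ofReal (T⁻¹ * E t) :=
        setLIntegral_mono' measurableSet_Icc fun t ht => ENNReal.ofReal_le_ofReal (hle t ht)
    _ = ENNReal.ofReal (∫ t in Set.Icc T S, T⁻¹ * E t) :=
        (ofReal_integral_eq_lintegral_ofReal (iE.const_mul _) (Eventually.of_forall fun t =>
          mul_nonneg (inv_nonneg.2 hT0.le) (hE0 t))).symm
    _ ≤ _ := by
      refine ENNReal.ofReal_le_ofReal ?_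
      rw [integral_const_mul, integral_Icc_eq_integral_Ioc,
        ← intervalIntegral.integral_of_le hTS]
      refine (mul_le_mul_of_nonneg_left main (inv_nonneg.2 hT0.le)).trans ?_
      have hTe : T = S / 2 := by linarith
      have k₀ : S ^ (b + b * (q + r) / 2 - 1) = S ^ b * S ^ (b * (q + r) / 2) / S := by
        rw [Real.rpow_sub hS0, Real.rpow_add hS0, Real.rpow_one]
      have k₁ : S ^ (b * (r - 3) / 2) = S ^ b * S ^ (b * (r - 5) / 2) := by
        rw [← Real.rpow_add hS0]; ring_nf
      have k₂ : S ^ (b * (1 - 3 * r) / 2) = S ^ b * S ^ (-(b * (1 + 3 * r) / 2)) := by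
        rw [← Real.rpow_add hS0]; ring_nf
      have k₃ : S ^ (b * (1 - q)) = S ^ b / S ^ (b * q) := by
        rw [← Real.rpow_sub hS0]; ring_nf
      rw [k₀, k₁, k₂, k₃, hTe]
      have hC1 : C * (S ^ b / S ^ (b * q)) ≤ (C + 1) * (S ^ b / S ^ (b * q)) := by
        have : 0 ≤ S ^ b / S ^ (b * q) := by positivity
        nlinarith
      have hA0 : 0 < S ^ (b * q) := by positivity
      calc _ = (C + 1) * (256 * (S ^ b * S ^ (b * (q + r) / 2) / S)
            + 320 * (S ^ b * S ^ (b * (r - 5) / 2))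
            + 320 * (S ^ b * S ^ (-(b * (1 + 3 * r) / 2)))) + 4 * (C * (S ^ b / S ^ (b * q))) := by
            field_simp
            ring
        _ ≤ _ := by linarith

end IsAdmissibleZK2

/-- Integrated local `L²` decay for 2D ZK:
`∫_{10}^∞ (1/(t log t)) ∫_{Ω(t)} u(t,x,y)² dxdy dt < ∞` where
`Ω(t) = {(x,y) : |x| < t^b, |y| < t^{br}}`. -/
theorem zk2_L2_integrated_decay
    (r b : ℝ) (hr₁ : 1/3 < r) (hr₂ : r < 3) (hb₁ : 0 < b) (hb₂ : b < 2/(3+r))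
    (u : ℝ → ℝ → ℝ → ℝ) (hu : IsAdmissibleZK2 u)
    (hL2 : ∃ C : ℝ, ∀ t : ℝ, 2 ≤ t → (∫ p : ℝ × ℝ, (u t p.1 p.2)^2) ≤ C) :
    (∫⁻ t in Set.Ici (10:ℝ),
      ENNReal.ofReal ((1/(t * Real.log t)) *
        ∫ p in {q : ℝ × ℝ | |q.1| < t ^ b ∧ |q.2| < t ^ (b*r)}, (u t p.1 p.2)^2)) < ⊤ := by
  obtain ⟨C, hC⟩ := hL2
  set ε := (2 / b - (3 + r)) / 2 with hε
  have hε0 : 0 < ε := by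
    have : 3 + r < 2 / b := by
      rw [lt_div_iff₀ hb₁, mul_comm]
      exact (lt_div_iff₀ (by linarith)).1 hb₂
    linarith
  have hbε : b * ε = 1 - b * (3 + r) / 2 := by
    rw [hε]
    field_simp
  have s₀ := (summable_dyadic_rpow (e := b + b * ((1 + ε) + r) / 2 - 1)
    (by nlinarith)).mul_left 256
  have s₁ := (summable_dyadic_rpow (e := b * (r - 3) / 2) (by nlinarith)).mul_left 320
  have s₂ := (summable_dyadic_rpow (e := b * (1 - 3 * r) / 2) (by nlinarith)).mul_left 320
  have s₃ := (summable_dyadic_rpow (e := b * (1 - (1 + ε))) (by nlinarith)).mul_left 4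
  have s := (((s₀.add s₁).add s₂).add s₃).mul_left (C + 1)
  refine (lintegral_mono_set Ici_ten_subset_iUnion_dyadic).trans_lt
    ((lintegral_iUnion_le _ _).trans_lt ?_)
  refine (ENNReal.tsum_le_tsum fun k => hu.lintegral_dyadic_le hb₁ (by linarith)
    (show 1 ≤ 1 + ε by linarith) hC ?_).trans_lt ?_
  · exact le_mul_of_one_le_right (by norm_num) (one_le_pow₀ one_le_two)
  · exact s.tsum_ofReal_lt_top
end
end

section
/- Let b ∈ (0,1), C₀ ≥ 0 and T ≥ 3. Let F : ℝ → ℝ be measurable with F(s) ≥ 0 for s ≥ T, and suppose that for every t ≥ T, ∫_t^∞ F(s)/(s log s) ds ≤ C₀ ∫_t^∞ 1/(s (log s)^{1/b}) ds (both Lebesgue integrals, the right-hand one being finite since 1/b > 1). Then for every t ≥ T there exists s ≥ t with F(s) ≤ 2 C₀ (log s)^{1 − 1/b}; consequently there is a strictly increasing sequence t_n → ∞ with F(t_n) ≤ 2 C₀ (log t_n)^{1 − 1/b} for every n. -/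
open MeasureTheory Filter

/-- `s ↦ 1 / (s (log s)^p)` is integrable at infinity for `p > 1`. -/
theorem integrableOn_Ioi_one_div_mul_log_rpow {p t : ℝ} (hp : 1 < p) (ht : 1 < t) :
    IntegrableOn (fun s : ℝ => 1 / (s * Real.log s ^ p)) (Set.Ioi t) := by
  have hderiv : ∀ s ∈ Set.Ici t,
      HasDerivAt (fun x : ℝ => Real.log x ^ (1 - p) / (1 - p)) (1 / (s * Real.log s ^ p)) s := by
    intro s hs
    have hs1 : 1 < s := ht.trans_le hs
    have hlog : 0 < Real.log s := Real.log_pos hs1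
    have h := ((Real.hasDerivAt_log (by positivity)).rpow_const (p := 1 - p)
      (Or.inl hlog.ne')).div_const (1 - p)
    refine h.congr_deriv ?_
    have hp' : 1 - p ≠ 0 := by linarith
    rw [sub_sub_cancel_left, Real.rpow_neg hlog.le]
    field_simp
  have hlim : Tendsto (fun x : ℝ => Real.log x ^ (1 - p) / (1 - p)) atTop (nhds (0 / (1 - p))) := by
    have h := (tendsto_rpow_neg_atTop (sub_pos.2 hp)).comp Real.tendsto_log_atTop
    rw [neg_sub] at h
    exact h.div_const _
  refine integrableOn_Ioi_deriv_of_nonneg' hderiv (fun s hs => ?_) hlim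
  have hs1 : 1 < s := ht.trans hs
  have hlog : 0 < Real.log s := Real.log_pos hs1
  positivity

/-- A property that holds at arbitrarily large reals holds along a strictly increasing sequence
tending to infinity. -/
theorem exists_strictMono_tendsto_atTop_of_forall_ge {P : ℝ → Prop} {T : ℝ}
    (h : ∀ t, T ≤ t → ∃ s, t ≤ s ∧ P s) :
    ∃ u : ℕ → ℝ, StrictMono u ∧ Tendsto u atTop atTop ∧ ∀ n, P (u n) := by
  have hfreq : ∃ᶠ s in atTop, P s := frequently_atTop.2 fun a =>
    let ⟨s, hs, hPs⟩ := h (max a T) (le_max_right a T)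
    ⟨s, (le_max_left a T).trans hs, hPs⟩
  obtain ⟨v, hv, hPv⟩ := exists_seq_forall_of_frequently hfreq
  obtain ⟨φ, hφ, hmono⟩ := strictMono_subseq_of_tendsto_atTop hv
  exact ⟨v ∘ φ, hmono, hv.comp hφ.tendsto_atTop, fun n => hPv (φ n)⟩

/-- Quantitative sequential decay: if `F ≥ 0` on `[T,∞)` and for all `t ≥ T`
`∫_t^∞ F(s)/(s log s) ds ≤ C₀ ∫_t^∞ ds/(s (log s)^{1/b})`, then beyond every time `t`
there is `s` with `F(s) ≤ 2C₀ (log s)^{1-1/b}`, and hence a strictly increasing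
sequence `tₙ → ∞` along which this decay rate holds. -/
theorem sequential_decay_rate
    (b C₀ T : ℝ) (hb : b ∈ Set.Ioo (0:ℝ) 1) (hC₀ : 0 ≤ C₀) (hT : 3 ≤ T)
    (F : ℝ → ℝ) (hFm : Measurable F) (hFpos : ∀ s : ℝ, T ≤ s → 0 ≤ F s)
    (hint : ∀ t : ℝ, T ≤ t →
      (∫⁻ s in Set.Ici t, ENNReal.ofReal (F s / (s * Real.log s)))
        ≤ ENNReal.ofReal C₀ *
            ∫⁻ s in Set.Ici t, ENNReal.ofReal (1 / (s * (Real.log s) ^ (1/b)))) :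
    (∀ t : ℝ, T ≤ t → ∃ s : ℝ, t ≤ s ∧ F s ≤ 2 * C₀ * (Real.log s) ^ (1 - 1/b)) ∧
    ∃ tseq : ℕ → ℝ, StrictMono tseq ∧ Tendsto tseq atTop atTop ∧
      ∀ n : ℕ, F (tseq n) ≤ 2 * C₀ * (Real.log (tseq n)) ^ (1 - 1/b) := by
  have hp : 1 < 1 / b := by
    rw [lt_div_iff₀ hb.1]
    linarith [hb.2]
  have hex : ∀ t : ℝ, T ≤ t →
      ∃ s : ℝ, t ≤ s ∧ F s ≤ 2 * C₀ * (Real.log s) ^ (1 - 1/b) := by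
    intro t ht
    by_contra! hF
    have hfin : ∫⁻ s in Set.Ici t, ENNReal.ofReal (1 / (s * Real.log s ^ (1/b))) ≠ ⊤ := by
      have h := integrableOn_Ioi_one_div_mul_log_rpow hp (t := t) (by linarith)
      rw [← integrableOn_Ici_iff_integrableOn_Ioi] at h
      exact h.lintegral_lt_top.ne
    refine (hint t ht).not_gt ?_
    rw [← lintegral_const_mul' _ _ ENNReal.ofReal_ne_top]
    refine setLIntegral_strict_mono measurableSet_Ici (by simp) (by fun_prop) ?_ ?_
    · rw [lintegral_const_mul' _ _ ENNReal.ofReal_ne_top]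
      exact ENNReal.mul_ne_top ENNReal.ofReal_ne_top hfin
    · refine .of_forall fun s hs => ?_
      have hs1 : 1 < s := by linarith [Set.mem_Ici.1 hs]
      have hlog : 0 < Real.log s := Real.log_pos hs1
      have hpow : 0 < Real.log s ^ (1 - 1/b) := Real.rpow_pos_of_pos hlog _
      have hF' : C₀ * Real.log s ^ (1 - 1/b) < F s := by
        nlinarith [hF s hs, mul_nonneg hC₀ hpow.le]
      have heq : C₀ * (1 / (s * Real.log s ^ (1/b)))
          = C₀ * Real.log s ^ (1 - 1/b) / (s * Real.log s) := by
        rw [Real.rpow_sub hlog, Real.rpow_one]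
        field_simp
      rw [← ENNReal.ofReal_mul hC₀, heq]
      refine (ENNReal.ofReal_lt_ofReal_iff_of_nonneg (by positivity)).2 ?_
      gcongr
  exact ⟨hex, exists_strictMono_tendsto_atTop_of_forall_ge hex⟩
end

section
/- Let b ∈ (0, 1/2], C₀ > 0, ε > 0 and A ≥ 3. Let F : ℝ → ℝ be continuous and nonnegative on [A,∞), and suppose that for all a, B with A ≤ a ≤ B, ∫_a^B F(s)/(s log s) ds ≤ C₀ (log a)^{−1/b} + C₀ ∫_a^B 1/(s (log s)^{1/b}) ds. If A ≤ a < B and F(s) > ε for every s ∈ (a, B), then log(log B) ≤ log(log a) + 2 C₀ / (ε (log a)^{1/b − 1}); equivalently, B ≤ a^{exp(2C₀/(ε (log a)^{1/b −1}))}. -/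
open MeasureTheory Filter intervalIntegral

theorem integral_one_div_mul_log {a B : ℝ} (ha : 1 < a) (haB : a ≤ B) :
    ∫ s in a..B, 1 / (s * Real.log s) =
      Real.log (Real.log B) - Real.log (Real.log a) := by
  have hs1 : ∀ s ∈ Set.uIcc a B, 1 < s := fun s hs ↦
    ha.trans_le (Set.uIcc_of_le haB ▸ hs).1
  refine integral_eq_sub_of_hasDerivAt (f := fun s ↦ Real.log (Real.log s)) (fun s hs ↦ ?_)
    (ContinuousOn.intervalIntegrable fun s hs ↦ ContinuousAt.continuousWithinAt ?_)
  · have h1 := hs1 s hs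
    have hl := Real.log_pos h1
    refine ((Real.hasDerivAt_log (by linarith : s ≠ 0)).log hl.ne').congr_deriv ?_
    field_simp
  · have h1 := hs1 s hs
    have hl := Real.log_pos h1
    have h0 : s ≠ 0 := by linarith
    exact continuousAt_const.div (continuousAt_id.mul (Real.continuousAt_log h0))
      (mul_ne_zero h0 hl.ne')

theorem integral_one_div_mul_log_rpow {a B p : ℝ} (ha : 1 < a) (haB : a ≤ B) (hp : p ≠ 1) :
    ∫ s in a..B, 1 / (s * Real.log s ^ p) =
      (Real.log B ^ (1 - p) - Real.log a ^ (1 - p)) / (1 - p) := by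
  have hp' : 1 - p ≠ 0 := sub_ne_zero.2 hp.symm
  have hs1 : ∀ s ∈ Set.uIcc a B, 1 < s := fun s hs ↦
    ha.trans_le (Set.uIcc_of_le haB ▸ hs).1
  rw [sub_div]
  refine integral_eq_sub_of_hasDerivAt (f := fun s ↦ Real.log s ^ (1 - p) / (1 - p))
    (fun s hs ↦ ?_)
    (ContinuousOn.intervalIntegrable fun s hs ↦ ContinuousAt.continuousWithinAt ?_)
  · have h1 := hs1 s hs
    have hl := Real.log_pos h1
    have h0 : s ≠ 0 := by linarith
    refine (((Real.hasDerivAt_log h0).rpow_const (p := 1 - p) (Or.inl hl.ne')).div_const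
      (1 - p)).congr_deriv ?_
    rw [sub_sub_cancel_left, Real.rpow_neg hl.le]
    field_simp
  · have h1 := hs1 s hs
    have hl := Real.log_pos h1
    have h0 : s ≠ 0 := by linarith
    exact continuousAt_const.div
      (continuousAt_id.mul ((Real.continuousAt_log h0).rpow_const (Or.inl hl.ne')))
      (mul_ne_zero h0 (Real.rpow_pos_of_pos hl p).ne')

/-- Bound on the length of intervals where the local mass stays above a threshold:
if `F` is continuous, nonnegative on `[A,∞)` and satisfies the integrated decay
estimate, and `F > ε` on `(a,B)`, then
`log(log B) ≤ log(log a) + 2C₀/(ε (log a)^{1/b−1})`; equivalently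
`B ≤ a^{exp(2C₀/(ε (log a)^{1/b−1}))}`. -/
theorem interval_above_threshold_bound
    (b C₀ ε A : ℝ) (hb₁ : 0 < b) (hb₂ : b ≤ 1/2) (hC₀ : 0 < C₀) (hε : 0 < ε)
    (hA : 3 ≤ A)
    (F : ℝ → ℝ) (hFc : ContinuousOn F (Set.Ici A)) (hFpos : ∀ s : ℝ, A ≤ s → 0 ≤ F s)
    (hint : ∀ a B : ℝ, A ≤ a → a ≤ B →
      (∫ s in a..B, F s / (s * Real.log s))
        ≤ C₀ * (Real.log a) ^ (-(1/b))
          + C₀ * ∫ s in a..B, 1 / (s * (Real.log s) ^ (1/b)))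
    (a B : ℝ) (haA : A ≤ a) (haB : a < B)
    (hF : ∀ s ∈ Set.Ioo a B, ε < F s) :
    Real.log (Real.log B)
        ≤ Real.log (Real.log a) + 2 * C₀ / (ε * (Real.log a) ^ (1/b - 1)) ∧
      B ≤ a ^ Real.exp (2 * C₀ / (ε * (Real.log a) ^ (1/b - 1))) := by
  have ha1 : 1 < a := by linarith
  have hp : 2 ≤ 1 / b := by
    rw [le_div_iff₀ hb₁]
    linarith
  have hla : 1 ≤ Real.log a := by
    rw [Real.le_log_iff_exp_le (by linarith)]
    linarith [Real.exp_one_lt_d9]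
  have hlB : 0 < Real.log B := Real.log_pos (ha1.trans haB)
  have hla0 : 0 < Real.log a := by linarith
  have hmain := hint a B haA haB.le
  set p := 1 / b
  have hlower : ε * (Real.log (Real.log B) - Real.log (Real.log a)) ≤
      ∫ s in a..B, F s / (s * Real.log s) := by
    rw [← integral_one_div_mul_log ha1 haB.le, ← intervalIntegral.integral_const_mul]
    have hcont : ∀ G : ℝ → ℝ, ContinuousOn G (Set.Icc a B) →
        IntervalIntegrable (fun s ↦ G s / (s * Real.log s)) volume a B := by
      intro G hG
      apply ContinuousOn.intervalIntegrable
      rw [Set.uIcc_of_le haB.le]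
      refine hG.div (continuousOn_id.mul (Real.continuousOn_log.mono fun s hs ↦ ?_))
        fun s hs ↦ ?_
      · exact (by linarith [hs.1] : s ≠ 0)
      · have h1 : 1 < s := ha1.trans_le hs.1
        exact (mul_pos (by linarith) (Real.log_pos h1)).ne'
    refine integral_mono_on_of_le_Ioo haB.le ((hcont _ continuousOn_const).const_mul ε)
      (hcont F (hFc.mono fun s hs ↦ haA.trans hs.1)) fun s hs ↦ ?_
    have h1 : 1 < s := ha1.trans hs.1
    have hl := Real.log_pos h1
    rw [mul_one_div]
    gcongr
    exact (hF s hs).le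
  have hfirst : Real.log a ^ (-p) ≤ Real.log a ^ (1 - p) :=
    Real.rpow_le_rpow_of_exponent_le hla (by linarith)
  have hsecond : ∫ s in a..B, 1 / (s * Real.log s ^ p) ≤ Real.log a ^ (1 - p) := by
    rw [integral_one_div_mul_log_rpow ha1 haB.le (by linarith), ← neg_div_neg_eq,
      div_le_iff₀ (by linarith)]
    nlinarith [Real.rpow_pos_of_pos hlB (1 - p), Real.rpow_pos_of_pos hla0 (1 - p)]
  have hbound : Real.log (Real.log B) ≤
      Real.log (Real.log a) + 2 * C₀ / (ε * Real.log a ^ (p - 1)) := by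
    have hpow : Real.log a ^ (p - 1) = (Real.log a ^ (1 - p))⁻¹ := by
      rw [← Real.rpow_neg hla0.le, neg_sub]
    have hq := Real.rpow_pos_of_pos hla0 (1 - p)
    have heq : 2 * C₀ / (ε * Real.log a ^ (p - 1)) = 2 * C₀ * Real.log a ^ (1 - p) / ε := by
      rw [hpow]
      field_simp
    rw [heq, ← sub_le_iff_le_add', le_div_iff₀ hε]
    nlinarith [mul_le_mul_of_nonneg_left hfirst hC₀.le, mul_le_mul_of_nonneg_left hsecond hC₀.le]
  refine ⟨hbound, ?_⟩
  rw [Real.rpow_def_of_pos (by linarith), ← Real.log_le_iff_le_exp (by linarith)]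
  have h := Real.exp_le_exp.2 hbound
  rwa [Real.exp_add, Real.exp_log hlB, Real.exp_log hla0] at h
end

section
/- Let K ≥ 1 and let w : ℝ² → ℝ be a bounded measurable function with w(p) > 0 for all p ∈ ℝ² and such that w(p) ≤ K w(q) whenever p, q ∈ ℝ² satisfy |p₁ − q₁| ≤ 1 and |p₂ − q₂| ≤ 1. Then there exists a constant C > 0, depending only on K, such that for every Schwartz function u : ℝ² → ℝ, ∫_{ℝ²} |u|³ w ≤ C ( ‖u‖_{L²(ℝ²)} + ‖∇u‖_{L²(ℝ²)} ) ∫_{ℝ²} u² w. -/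
open MeasureTheory

/-- One-dimensional Sobolev inequality on a unit interval: the square of a `C¹` function is
pointwise controlled by an integral over the interval. -/
theorem sq_le_setIntegral_sq_add_of_hasDerivAt {f f' g : ℝ → ℝ} (hf : ∀ x, HasDerivAt f (f' x) x)
    (hf' : Continuous f') (hg : Continuous g) (hfg : ∀ x, |f' x| ≤ g x) {a x : ℝ}
    (hx : x ∈ Set.Ioc a (a + 1)) :
    f x ^ 2 ≤ ∫ s in Set.Ioc a (a + 1), (f s ^ 2 + 2 * |f s| * g s) := by
  have hfc : Continuous f := continuous_iff_continuousAt.2 fun x => (hf x).continuousAt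
  have hint : ∀ φ : ℝ → ℝ, Continuous φ → IntegrableOn φ (Set.Ioc a (a + 1)) :=
    fun φ hφ => (hφ.integrableOn_Icc).mono_set Set.Ioc_subset_Icc_self
  set J := ∫ s in Set.Ioc a (a + 1), 2 * |f s| * g s
  have key : ∀ s ∈ Set.Ioc a (a + 1), f x ^ 2 - J ≤ f s ^ 2 := by
    intro s hs
    have hftc : ∫ t in s..x, 2 * f t * f' t = f x ^ 2 - f s ^ 2 := by
      apply intervalIntegral.integral_eq_sub_of_hasDerivAt (f := fun t => f t ^ 2)
      · intro t _
        have h := (hf t).fun_pow 2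
        simpa only [Nat.cast_ofNat, Nat.add_one_sub_one, pow_one] using h
      · exact Continuous.intervalIntegrable (by fun_prop) _ _
    have hle : f x ^ 2 - f s ^ 2 ≤ J := by
      rw [← hftc]
      refine (le_abs_self _).trans ?_
      rw [← Real.norm_eq_abs]
      refine intervalIntegral.norm_integral_le_integral_norm_uIoc.trans ?_
      calc ∫ t in Set.uIoc s x, ‖2 * f t * f' t‖
          ≤ ∫ t in Set.Ioc a (a + 1), ‖2 * f t * f' t‖ := by
            apply setIntegral_mono_set (hint _ (by fun_prop))
            · exact Filter.Eventually.of_forall fun t => norm_nonneg _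
            · exact (Set.Ioc_subset_Ioc (le_min hs.1.le hx.1.le)
                (max_le hs.2 hx.2)).eventuallyLE
        _ ≤ J := by
            apply setIntegral_mono (hint _ (by fun_prop)) (hint _ (by fun_prop))
            intro t
            simp only [norm_mul, Real.norm_eq_abs, abs_two]
            exact mul_le_mul_of_nonneg_left (hfg t) (by positivity)
    linarith
  have hmono := setIntegral_mono_on (hint _ (continuous_const (y := f x ^ 2 - J)))
    (hint (fun s => f s ^ 2) (by fun_prop)) measurableSet_Ioc key
  rw [integral_add (hint _ (by fun_prop)) (hint _ (by fun_prop))]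
  simp at hmono
  linarith

/-- Cauchy–Schwarz for square-integrable real functions. -/
theorem integral_mul_le_sqrt_mul_sqrt {α : Type*} [MeasurableSpace α] {μ : Measure α}
    {f g : α → ℝ} (hf0 : ∀ x, 0 ≤ f x) (hg0 : ∀ x, 0 ≤ g x) (hf : MemLp f 2 μ)
    (hg : MemLp g 2 μ) :
    ∫ x, f x * g x ∂μ ≤ Real.sqrt (∫ x, f x ^ 2 ∂μ) * Real.sqrt (∫ x, g x ^ 2 ∂μ) := by
  have h := integral_mul_le_Lp_mul_Lq_of_nonneg (μ := μ) (f := f) (g := g)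
    Real.HolderConjugate.two_two (Filter.Eventually.of_forall hf0)
    (Filter.Eventually.of_forall hg0) (by simpa using hf) (by simpa using hg)
  simpa [Real.sqrt_eq_rpow] using h

/-- Ladyzhenskaya's inequality on a unit cell, before applying Cauchy–Schwarz. -/
theorem setIntegral_pow_four_le_sq {u : ℝ × ℝ → ℝ} (hu : ContDiff ℝ 1 u) (a b : ℝ) :
    ∫ p in Set.Ioc a (a + 1) ×ˢ Set.Ioc b (b + 1), u p ^ 4 ≤
      (∫ p in Set.Ioc a (a + 1) ×ˢ Set.Ioc b (b + 1),
        (u p ^ 2 + 2 * |u p| * ‖fderiv ℝ u p‖)) ^ 2 := by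
  have huc := hu.continuous
  have hdc : Continuous (fderiv ℝ u) := hu.continuous_fderiv one_ne_zero
  have hint : ∀ φ : ℝ × ℝ → ℝ, Continuous φ →
      IntegrableOn φ (Set.Ioc a (a + 1) ×ˢ Set.Ioc b (b + 1)) := fun φ hφ =>
    (hφ.continuousOn.integrableOn_compact (isCompact_Icc.prod isCompact_Icc)).mono_set
      (Set.prod_mono Set.Ioc_subset_Icc_self Set.Ioc_subset_Icc_self)
  set h : ℝ × ℝ → ℝ := fun p => u p ^ 2 + 2 * |u p| * ‖fderiv ℝ u p‖
  have hhc : Continuous h := by fun_prop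
  have hd : ∀ p, HasFDerivAt u (fderiv ℝ u p) p := fun p =>
    (hu.differentiable one_ne_zero p).hasFDerivAt
  have hF : ∀ p ∈ Set.Ioc a (a + 1) ×ˢ Set.Ioc b (b + 1),
      u p ^ 2 ≤ ∫ s in Set.Ioc a (a + 1), h (s, p.2) := by
    rintro ⟨x, y⟩ ⟨hx, -⟩
    refine sq_le_setIntegral_sq_add_of_hasDerivAt (f := fun s => u (s, y))
      (f' := fun s => fderiv ℝ u (s, y) (1, 0)) (g := fun s => ‖fderiv ℝ u (s, y)‖)
      (fun s => ?_) (by fun_prop) (by fun_prop) (fun s => ?_) hx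
    · exact (hd (s, y)).comp_hasDerivAt s ((hasDerivAt_id s).prodMk (hasDerivAt_const s y))
    · simpa using (fderiv ℝ u (s, y)).le_opNorm (1, 0)
  have hG : ∀ p ∈ Set.Ioc a (a + 1) ×ˢ Set.Ioc b (b + 1),
      u p ^ 2 ≤ ∫ t in Set.Ioc b (b + 1), h (p.1, t) := by
    rintro ⟨x, y⟩ ⟨-, hy⟩
    refine sq_le_setIntegral_sq_add_of_hasDerivAt (f := fun t => u (x, t))
      (f' := fun t => fderiv ℝ u (x, t) (0, 1)) (g := fun t => ‖fderiv ℝ u (x, t)‖)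
      (fun t => ?_) (by fun_prop) (by fun_prop) (fun t => ?_) hy
    · exact (hd (x, t)).comp_hasDerivAt t ((hasDerivAt_const t x).prodMk (hasDerivAt_id t))
    · simpa using (fderiv ℝ u (x, t)).le_opNorm (0, 1)
  have hhi : Integrable h ((volume.restrict (Set.Ioc a (a + 1))).prod
      (volume.restrict (Set.Ioc b (b + 1)))) := by
    rw [Measure.prod_restrict]
    exact hint h hhc
  have h1 : ∫ p in Set.Ioc a (a + 1) ×ˢ Set.Ioc b (b + 1), h p =
      ∫ x in Set.Ioc a (a + 1), ∫ t in Set.Ioc b (b + 1), h (x, t) := by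
    rw [Measure.volume_eq_prod, ← Measure.prod_restrict]
    exact integral_prod _ hhi
  have h2 : ∫ p in Set.Ioc a (a + 1) ×ˢ Set.Ioc b (b + 1), h p =
      ∫ y in Set.Ioc b (b + 1), ∫ s in Set.Ioc a (a + 1), h (s, y) := by
    rw [Measure.volume_eq_prod, ← Measure.prod_restrict]
    exact integral_prod_symm _ hhi
  have hprod : IntegrableOn (fun p : ℝ × ℝ => (∫ t in Set.Ioc b (b + 1), h (p.1, t)) *
      ∫ s in Set.Ioc a (a + 1), h (s, p.2)) (Set.Ioc a (a + 1) ×ˢ Set.Ioc b (b + 1)) := by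
    rw [IntegrableOn, Measure.volume_eq_prod, ← Measure.prod_restrict]
    exact hhi.integral_prod_left.mul_prod hhi.integral_prod_right
  calc ∫ p in Set.Ioc a (a + 1) ×ˢ Set.Ioc b (b + 1), u p ^ 4
      ≤ ∫ p in Set.Ioc a (a + 1) ×ˢ Set.Ioc b (b + 1),
          (∫ t in Set.Ioc b (b + 1), h (p.1, t)) * ∫ s in Set.Ioc a (a + 1), h (s, p.2) := by
        refine setIntegral_mono_on (hint _ (by fun_prop)) hprod
          (measurableSet_Ioc.prod measurableSet_Ioc) fun p hp => ?_
        calc u p ^ 4 = u p ^ 2 * u p ^ 2 := by ring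
          _ ≤ _ := mul_le_mul (hG p hp) (hF p hp) (sq_nonneg _)
            ((sq_nonneg _).trans (hG p hp))
    _ = (∫ p in Set.Ioc a (a + 1) ×ˢ Set.Ioc b (b + 1), h p) ^ 2 := by
        rw [sq]
        nth_rewrite 1 [h1]
        rw [h2]
        exact setIntegral_prod_mul (fun x => ∫ t in Set.Ioc b (b + 1), h (x, t))
          (fun y => ∫ s in Set.Ioc a (a + 1), h (s, y)) _ _

/-- Gagliardo–Nirenberg inequality on a unit cell, with global norms of `u` and its derivative
as coefficient. -/
theorem setIntegral_abs_pow_three_le {u : ℝ × ℝ → ℝ} (hu : ContDiff ℝ 1 u)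
    (hu2 : MemLp u 2) (hd2 : MemLp (fderiv ℝ u) 2) (a b : ℝ) :
    ∫ p in Set.Ioc a (a + 1) ×ˢ Set.Ioc b (b + 1), |u p| ^ 3 ≤
      (Real.sqrt (∫ p, u p ^ 2) + 2 * Real.sqrt (∫ p, ‖fderiv ℝ u p‖ ^ 2)) *
        ∫ p in Set.Ioc a (a + 1) ×ˢ Set.Ioc b (b + 1), u p ^ 2 := by
  have huc := hu.continuous
  have hdc : Continuous (fderiv ℝ u) := hu.continuous_fderiv one_ne_zero
  have hint : ∀ φ : ℝ × ℝ → ℝ, Continuous φ →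
      IntegrableOn φ (Set.Ioc a (a + 1) ×ˢ Set.Ioc b (b + 1)) := fun φ hφ =>
    (hφ.continuousOn.integrableOn_compact (isCompact_Icc.prod isCompact_Icc)).mono_set
      (Set.prod_mono Set.Ioc_subset_Icc_self Set.Ioc_subset_Icc_self)
  have hE := setIntegral_pow_four_le_sq hu a b
  set Q := Set.Ioc a (a + 1) ×ˢ Set.Ioc b (b + 1)
  have hcs := integral_mul_le_sqrt_mul_sqrt (μ := volume.restrict Q) (f := fun p => |u p|)
    (g := fun p => ‖fderiv ℝ u p‖) (fun _ => abs_nonneg _) (fun _ => norm_nonneg _)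
    (hu2.norm.restrict Q) (hd2.norm.restrict Q)
  simp only [sq_abs] at hcs
  have hD0 : 0 ≤ ∫ p in Q, u p ^ 2 := integral_nonneg fun _ => sq_nonneg _
  have hDU : ∫ p in Q, u p ^ 2 ≤ ∫ p, u p ^ 2 :=
    setIntegral_le_integral hu2.integrable_sq (Filter.Eventually.of_forall fun _ => sq_nonneg _)
  have hSG : ∫ p in Q, ‖fderiv ℝ u p‖ ^ 2 ≤ ∫ p, ‖fderiv ℝ u p‖ ^ 2 :=
    setIntegral_le_integral hd2.norm.integrable_sq
      (Filter.Eventually.of_forall fun _ => sq_nonneg _)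
  have hsplit : ∫ p in Q, (u p ^ 2 + 2 * |u p| * ‖fderiv ℝ u p‖) =
      (∫ p in Q, u p ^ 2) + 2 * ∫ p in Q, |u p| * ‖fderiv ℝ u p‖ := by
    rw [integral_add (hint _ (by fun_prop)) (hint _ (by fun_prop)), ← integral_const_mul]
    simp only [mul_assoc]
  have hI0 : 0 ≤ ∫ p in Q, |u p| * ‖fderiv ℝ u p‖ := integral_nonneg fun _ => by positivity
  set D := ∫ p in Q, u p ^ 2
  set L := Real.sqrt (∫ p, u p ^ 2) + 2 * Real.sqrt (∫ p, ‖fderiv ℝ u p‖ ^ 2) with hL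
  have hL0 : 0 ≤ L := by positivity
  have hsD := Real.sqrt_le_sqrt hDU
  have hh : ∫ p in Q, (u p ^ 2 + 2 * |u p| * ‖fderiv ℝ u p‖) ≤ Real.sqrt D * L := by
    rw [hsplit]
    calc D + 2 * ∫ p in Q, |u p| * ‖fderiv ℝ u p‖
        ≤ Real.sqrt D * Real.sqrt D +
          2 * (Real.sqrt D * Real.sqrt (∫ p in Q, ‖fderiv ℝ u p‖ ^ 2)) := by
          rw [Real.mul_self_sqrt hD0]; linarith
      _ ≤ Real.sqrt D * Real.sqrt (∫ p, u p ^ 2) +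
          2 * (Real.sqrt D * Real.sqrt (∫ p, ‖fderiv ℝ u p‖ ^ 2)) := by gcongr
      _ = Real.sqrt D * L := by rw [hL]; ring
  have hE' : ∫ p in Q, u p ^ 4 ≤ D * L ^ 2 := by
    refine hE.trans ((pow_le_pow_left₀ (by rw [hsplit]; positivity) hh 2).trans_eq ?_)
    rw [mul_pow, Real.sq_sqrt hD0]
  have hyoung : ∀ c : ℝ, 0 < c →
      2 * c * ∫ p in Q, |u p| ^ 3 ≤ c ^ 2 * D + ∫ p in Q, u p ^ 4 := by
    intro c _
    rw [← integral_const_mul, ← integral_const_mul,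
      ← integral_add (hint _ (by fun_prop)) (hint _ (by fun_prop))]
    refine setIntegral_mono (hint _ (by fun_prop)) (hint _ (by fun_prop)) fun p => ?_
    have h2 : u p ^ 2 = |u p| ^ 2 := (sq_abs _).symm
    have h4 : u p ^ 4 = |u p| ^ 4 := by rw [show 4 = 2 * 2 from rfl, pow_mul, pow_mul, sq_abs]
    simp only [h2, h4]
    nlinarith [mul_nonneg (sq_nonneg |u p|) (sq_nonneg (c - |u p|))]
  rcases hL0.eq_or_lt with h0 | hpos
  · have hU : Real.sqrt (∫ p, u p ^ 2) = 0 :=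
      le_antisymm (by rw [h0, hL]; linarith [Real.sqrt_nonneg (∫ p, ‖fderiv ℝ u p‖ ^ 2)])
        (Real.sqrt_nonneg _)
    have hD : D = 0 := by
      rw [hU] at hsD
      exact le_antisymm (Real.sqrt_eq_zero'.1 (le_antisymm hsD (Real.sqrt_nonneg _))) hD0
    have := hyoung 1 one_pos
    rw [hD] at this hE' ⊢
    linarith
  · have := hyoung L hpos
    refine le_of_mul_le_mul_left ?_ (show 0 < 2 * L by positivity)
    nlinarith

/-- A function on the plane whose integral over every integer unit cell is nonpositive has
nonpositive integral. -/
theorem integral_nonpos_of_forall_unit_cell {f : ℝ × ℝ → ℝ} (hf : Integrable f)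
    (h : ∀ a b : ℝ, ∫ p in Set.Ioc a (a + 1) ×ˢ Set.Ioc b (b + 1), f p ≤ 0) :
    ∫ p, f p ≤ 0 := by
  have hU : ⋃ n : ℤ × ℤ, Set.Ioc (n.1 : ℝ) (n.1 + 1) ×ˢ Set.Ioc (n.2 : ℝ) (n.2 + 1) =
      Set.univ := by
    rw [← Set.univ_prod_univ, ← iUnion_Ioc_intCast ℝ]
    exact (Set.iUnion_prod (fun n : ℤ => Set.Ioc (n : ℝ) (n + 1))
      (fun n : ℤ => Set.Ioc (n : ℝ) (n + 1)))
  have hdis : Pairwise (Function.onFun Disjoint fun n : ℤ × ℤ =>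
      Set.Ioc (n.1 : ℝ) (n.1 + 1) ×ˢ Set.Ioc (n.2 : ℝ) (n.2 + 1)) := by
    intro m n hmn
    refine Set.disjoint_prod.2 ?_
    by_cases h1 : m.1 = n.1
    · exact Or.inr (Set.pairwise_disjoint_Ioc_intCast ℝ fun h2 => hmn (Prod.ext h1 h2))
    · exact Or.inl (Set.pairwise_disjoint_Ioc_intCast ℝ h1)
  have hs := hasSum_integral_iUnion (f := f) (μ := volume)
    (fun n : ℤ × ℤ => (measurableSet_Ioc (a := (n.1 : ℝ)) (b := n.1 + 1)).prod
      (measurableSet_Ioc (a := (n.2 : ℝ)) (b := n.2 + 1))) hdis hf.integrableOn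
  rw [hU, setIntegral_univ] at hs
  exact hs.nonpos fun n => h _ _

/-- Weighted Gagliardo–Nirenberg-type estimate: for a positive bounded measurable
weight `w` on `ℝ²` that varies by at most a factor `K` over unit cells, and any
Schwartz function `u`, the weighted cubic integral is controlled by
`(‖u‖_{L²} + ‖∇u‖_{L²})` times the weighted quadratic integral, with a constant
depending only on `K`. -/
theorem weighted_cubic_estimate (K : ℝ) (hK : 1 ≤ K) :
    ∃ C : ℝ, 0 < C ∧
      ∀ w : ℝ × ℝ → ℝ, Measurable w → (∃ M : ℝ, ∀ p : ℝ × ℝ, w p ≤ M) →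
        (∀ p : ℝ × ℝ, 0 < w p) →
        (∀ p q : ℝ × ℝ, |p.1 - q.1| ≤ 1 → |p.2 - q.2| ≤ 1 → w p ≤ K * w q) →
        ∀ u : SchwartzMap (ℝ × ℝ) ℝ,
          (∫ p : ℝ × ℝ, |u p| ^ 3 * w p)
            ≤ C * (Real.sqrt (∫ p : ℝ × ℝ, (u p) ^ 2)
                    + Real.sqrt (∫ p : ℝ × ℝ, ‖fderiv ℝ (⇑u) p‖ ^ 2))
                * ∫ p : ℝ × ℝ, (u p) ^ 2 * w p := by
  refine ⟨2 * K ^ 2, by positivity, ?_⟩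
  rintro w hwm ⟨M, hM⟩ hw0 hwK u
  have hu2 : MemLp u 2 := u.memLp 2
  have hd2 : MemLp (fderiv ℝ u) 2 := by
    exact (SchwartzMap.fderivCLM ℝ (ℝ × ℝ) ℝ u).memLp 2 volume
  have hbdd : ∀ f : ℝ × ℝ → ℝ, Integrable f → Integrable (fun p => f p * w p) := fun f hf =>
    hf.mul_bdd (c := M) hwm.aestronglyMeasurable
      (Filter.Eventually.of_forall fun p => by simpa [abs_of_pos (hw0 p)] using hM p)
  have hi3 : Integrable (fun p => |u p| ^ 3) := by
    simpa using (u.memLp 3).integrable_norm_pow (by norm_num)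
  have hi2 : Integrable (fun p => u p ^ 2) := hu2.integrable_sq
  set U := Real.sqrt (∫ p, u p ^ 2)
  set G := Real.sqrt (∫ p, ‖fderiv ℝ (⇑u) p‖ ^ 2)
  have hU : 0 ≤ U := Real.sqrt_nonneg _
  have hG : 0 ≤ G := Real.sqrt_nonneg _
  rw [← sub_nonpos, ← integral_const_mul, ← integral_sub (hbdd _ hi3)
    ((hbdd _ hi2).const_mul _)]
  refine integral_nonpos_of_forall_unit_cell ((hbdd _ hi3).sub ((hbdd _ hi2).const_mul _))
    fun a b => ?_
  have hcell := setIntegral_abs_pow_three_le (u.smooth 1) hu2 hd2 a b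
  rw [integral_sub (hbdd _ hi3).integrableOn ((hbdd _ hi2).const_mul _).integrableOn,
    integral_const_mul, sub_nonpos]
  set Q := Set.Ioc a (a + 1) ×ˢ Set.Ioc b (b + 1)
  have hQm : MeasurableSet Q := measurableSet_Ioc.prod measurableSet_Ioc
  have habs : ∀ p ∈ Q, |p.1 - a| ≤ 1 ∧ |p.2 - b| ≤ 1 := by
    rintro p ⟨⟨h1, h2⟩, h3, h4⟩
    exact ⟨abs_le.2 ⟨by linarith, by linarith⟩, abs_le.2 ⟨by linarith, by linarith⟩⟩
  have hup : ∫ p in Q, |u p| ^ 3 * w p ≤ (∫ p in Q, |u p| ^ 3) * (K * w (a, b)) := by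
    rw [← integral_mul_const]
    refine setIntegral_mono_on (hbdd _ hi3).integrableOn (hi3.mul_const _).integrableOn hQm
      fun p hp => ?_
    exact mul_le_mul_of_nonneg_left (hwK p (a, b) (habs p hp).1 (habs p hp).2) (by positivity)
  have hlow : (∫ p in Q, u p ^ 2) * w (a, b) ≤ K * ∫ p in Q, u p ^ 2 * w p := by
    rw [← integral_mul_const, ← integral_const_mul]
    refine setIntegral_mono_on (hi2.mul_const _).integrableOn
      ((hbdd _ hi2).const_mul _).integrableOn hQm fun p hp => ?_
    have := hwK (a, b) p (by rw [abs_sub_comm]; exact (habs p hp).1)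
      (by rw [abs_sub_comm]; exact (habs p hp).2)
    nlinarith [mul_le_mul_of_nonneg_left this (sq_nonneg (u p))]
  have hW : 0 ≤ ∫ p in Q, u p ^ 2 * w p :=
    integral_nonneg fun p => mul_nonneg (sq_nonneg _) (hw0 p).le
  have hwab := hw0 (a, b)
  calc ∫ p in Q, |u p| ^ 3 * w p
      ≤ (∫ p in Q, |u p| ^ 3) * (K * w (a, b)) := hup
    _ ≤ ((U + 2 * G) * ∫ p in Q, u p ^ 2) * (K * w (a, b)) := by gcongr
    _ = (U + 2 * G) * K * ((∫ p in Q, u p ^ 2) * w (a, b)) := by ring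
    _ ≤ (U + 2 * G) * K * (K * ∫ p in Q, u p ^ 2 * w p) := by gcongr
    _ ≤ (2 * U + 2 * G) * K * (K * ∫ p in Q, u p ^ 2 * w p) := by gcongr; linarith
    _ = 2 * K ^ 2 * (U + G) * ∫ p in Q, u p ^ 2 * w p := by ring
end
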